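/- arXiv:2512.07708 — 17 statements merged into one kernel-verified Lean document; each statement's English description precedes it below -/
import Mathlib

section
/- Suppose H(t₀) > 0. Then H(t) ≥ √(Λ/3) for all t ≥ t₀; in particular H never vanishes on [t₀,∞), so no recollapse is possible. (First part of the topo-GR isotropization theorem, Theorem 4.1.) -/
open Real Filter

/-- First part of the topo-GR isotropization theorem (Theorem 4.1):
in the homogeneous 3+1 equations of topo-GR with vanishing reference tilt,
if `H t₀ > 0` then `H t ≥ √(Λ/3)` for all `t ≥ t₀`; in particular `H`
never vanishes on `[t₀,∞)`, so no recollapse is possible. -/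
theorem topoGR_no_recollapse
    (κ Λ t₀ : ℝ) (hκ : 0 < κ) (hΛ : 0 < Λ)
    (H H' S K ρ p : ℝ → ℝ)
    (hHdiff : ∀ t ≥ t₀, HasDerivAt H (H' t) t)
    (hScont : ContinuousOn S (Set.Ici t₀))
    (hKcont : ContinuousOn K (Set.Ici t₀))
    (hρcont : ContinuousOn ρ (Set.Ici t₀))
    (hpcont : ContinuousOn p (Set.Ici t₀))
    (hS : ∀ t ≥ t₀, 0 ≤ S t)
    (hK : ∀ t ≥ t₀, K t ≤ 0)
    (hρnn : ∀ t ≥ t₀, 0 ≤ ρ t)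
    (hsec : ∀ t ≥ t₀, 0 ≤ ρ t + 3 * p t)
    (hHam : ∀ t ≥ t₀, 6 * (H t) ^ 2 = 2 * κ * ρ t + 2 * Λ + S t - K t)
    (hRay : ∀ t ≥ t₀,
      3 * H' t = -3 * (H t) ^ 2 - S t - (κ / 2) * (ρ t + 3 * p t) + Λ)
    (hH0 : 0 < H t₀) :
    (∀ t ≥ t₀, Real.sqrt (Λ / 3) ≤ H t) ∧ (∀ t ≥ t₀, H t ≠ 0) := by
  have hsq : ∀ t ≥ t₀, Λ / 3 ≤ H t ^ 2 := fun t ht => by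
    have := mul_nonneg hκ.le (hρnn t ht)
    linarith [hHam t ht, hS t ht, hK t ht]
  have hne : ∀ t ≥ t₀, H t ≠ 0 := fun t ht h0 => by
    have := hsq t ht
    rw [h0] at this
    linarith
  have hcont : ContinuousOn H (Set.Ici t₀) := fun t ht =>
    (hHdiff t ht).continuousAt.continuousWithinAt
  have hpos : ∀ t ≥ t₀, 0 < H t := fun t ht => by
    by_contra! hle
    obtain ⟨s, hs, hs0⟩ :=
      intermediate_value_Icc' ht (hcont.mono Set.Icc_subset_Ici_self) ⟨hle, hH0.le⟩
    exact hne s hs.1 hs0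
  exact ⟨fun t ht => Real.sqrt_le_iff.mpr ⟨(hpos t ht).le, hsq t ht⟩, hne⟩
end

section
/- Suppose H(t₀) > 0. Then as t → ∞: H(t) → √(Λ/3), S(t) → 0, ρ(t) → 0 and K(t) → 0. In particular the shear tends to zero (isotropization) and the spatial scalar curvature approaches the reference scalar curvature. (Asymptotic part of the topo-GR isotropization theorem, Theorem 4.1.) -/
open Real Filter

/-- A function that is continuous on `[t₀, ∞)`, positive at `t₀` and never zero stays positive. -/
lemma pos_of_continuousOn_Ici_of_ne_zero {f : ℝ → ℝ} {t₀ : ℝ}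
    (hf : ContinuousOn f (Set.Ici t₀)) (hne : ∀ t ≥ t₀, f t ≠ 0) (h₀ : 0 < f t₀)
    {t : ℝ} (ht : t₀ ≤ t) : 0 < f t := by
  by_contra! hneg
  obtain ⟨s, hs, hs0⟩ :=
    intermediate_value_Icc' ht (hf.mono Set.Icc_subset_Ici_self) ⟨hneg, h₀.le⟩
  exact hne s hs.1 hs0

/-- Exponential decay from a linear differential inequality: if `f' ≤ -c f` on `[t₀, ∞)`, then
`f t ≤ f t₀ * exp (-c (t - t₀))` there. -/
lemma le_mul_exp_of_hasDerivAt_le {f f' : ℝ → ℝ} {c t₀ : ℝ}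
    (hf : ∀ t ≥ t₀, HasDerivAt f (f' t) t) (hle : ∀ t ≥ t₀, f' t ≤ -c * f t)
    {t : ℝ} (ht : t₀ ≤ t) : f t ≤ f t₀ * exp (-c * (t - t₀)) := by
  have hderiv : ∀ s ≥ t₀, HasDerivAt (fun s => f s * exp (c * (s - t₀)))
      (f' s * exp (c * (s - t₀)) + f s * (exp (c * (s - t₀)) * (c * 1))) s := fun s hs =>
    (hf s hs).mul ((((hasDerivAt_id s).sub_const t₀).const_mul c).exp)
  have hanti : AntitoneOn (fun s => f s * exp (c * (s - t₀))) (Set.Ici t₀) := by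
    refine antitoneOn_of_deriv_nonpos (convex_Ici t₀)
      (fun s hs => (hderiv s hs).continuousAt.continuousWithinAt) ?_ ?_
    · intro s hs
      exact (hderiv s (interior_subset hs)).differentiableAt.differentiableWithinAt
    · intro s hs
      rw [(hderiv s (interior_subset hs)).deriv]
      nlinarith [hle s (interior_subset hs), exp_pos (c * (s - t₀))]
  have h : f t * exp (c * (t - t₀)) ≤ f t₀ := by
    simpa using hanti Set.self_mem_Ici ht ht
  rw [neg_mul, exp_neg, ← div_eq_mul_inv]
  exact (le_div_iff₀ (exp_pos _)).2 h

/-- Asymptotic part of the topo-GR isotropization theorem (Theorem 4.1):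
in the homogeneous 3+1 equations of topo-GR with vanishing reference tilt,
if `H t₀ > 0` then as `t → ∞` one has `H → √(Λ/3)`, the shear magnitude
`S → 0`, the density `ρ → 0` and `K = R − R̄ → 0` (isotropization). -/
theorem topoGR_isotropization
    (κ Λ t₀ : ℝ) (hκ : 0 < κ) (hΛ : 0 < Λ)
    (H H' S K ρ p : ℝ → ℝ)
    (hHdiff : ∀ t ≥ t₀, HasDerivAt H (H' t) t)
    (hScont : ContinuousOn S (Set.Ici t₀))
    (hKcont : ContinuousOn K (Set.Ici t₀))
    (hρcont : ContinuousOn ρ (Set.Ici t₀))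
    (hpcont : ContinuousOn p (Set.Ici t₀))
    (hS : ∀ t ≥ t₀, 0 ≤ S t)
    (hK : ∀ t ≥ t₀, K t ≤ 0)
    (hρnn : ∀ t ≥ t₀, 0 ≤ ρ t)
    (hsec : ∀ t ≥ t₀, 0 ≤ ρ t + 3 * p t)
    (hHam : ∀ t ≥ t₀, 6 * (H t) ^ 2 = 2 * κ * ρ t + 2 * Λ + S t - K t)
    (hRay : ∀ t ≥ t₀,
      3 * H' t = -3 * (H t) ^ 2 - S t - (κ / 2) * (ρ t + 3 * p t) + Λ)
    (hH0 : 0 < H t₀) :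
    Tendsto H atTop (nhds (Real.sqrt (Λ / 3))) ∧
    Tendsto S atTop (nhds 0) ∧
    Tendsto ρ atTop (nhds 0) ∧
    Tendsto K atTop (nhds 0) := by
  set a := √(Λ / 3)
  have ha_pos : 0 < a := Real.sqrt_pos.2 (by positivity)
  have ha_sq : a ^ 2 = Λ / 3 := Real.sq_sqrt (by positivity)
  have hκρ : ∀ t ≥ t₀, 0 ≤ κ * ρ t := fun t ht => mul_nonneg hκ.le (hρnn t ht)
  have hH_sq : ∀ t ≥ t₀, a ^ 2 ≤ H t ^ 2 := fun t ht => by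
    linarith [hHam t ht, hS t ht, hK t ht, hκρ t ht]
  have hH_pos : ∀ t ≥ t₀, 0 < H t := fun t ht =>
    pos_of_continuousOn_Ici_of_ne_zero
      (fun s hs => (hHdiff s hs).continuousAt.continuousWithinAt)
      (fun s hs h0 => by nlinarith [hH_sq s hs]) hH0 ht
  have hH_ge : ∀ t ≥ t₀, a ≤ H t := fun t ht =>
    le_of_sq_le_sq (hH_sq t ht) (hH_pos t ht).le
  have hH_le : ∀ t ≥ t₀, H t - a ≤ (H t₀ - a) * exp (-(2 * a) * (t - t₀)) := fun t ht =>
    le_mul_exp_of_hasDerivAt_le (f := fun t => H t - a)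
      (fun s hs => (hHdiff s hs).sub_const a)
      (fun s hs => by
        nlinarith [hRay s hs, hS s hs, mul_nonneg hκ.le (hsec s hs), sq_nonneg (H s - a)]) ht
  have hexp : Tendsto (fun t => (H t₀ - a) * exp (-(2 * a) * (t - t₀))) atTop (nhds 0) := by
    have h : Tendsto (fun t => -(2 * a) * (t - t₀)) atTop atBot :=
      (tendsto_atTop_add_const_right atTop (-t₀) tendsto_id).const_mul_atTop_of_neg
        (by linarith)
    simpa using (tendsto_exp_atBot.comp h).const_mul (H t₀ - a)
  have hlarge : ∀ᶠ t in atTop, t₀ ≤ t := eventually_ge_atTop t₀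
  have hH : Tendsto H atTop (nhds a) := by
    rw [← tendsto_sub_nhds_zero_iff]
    exact squeeze_zero' (hlarge.mono fun t ht => sub_nonneg.2 (hH_ge t ht))
      (hlarge.mono hH_le) hexp
  have hexcess : Tendsto (fun t => 6 * H t ^ 2 - 2 * Λ) atTop (nhds 0) := by
    have h := ((hH.pow 2).const_mul 6).sub_const (2 * Λ)
    rwa [show 6 * a ^ 2 - 2 * Λ = 0 by rw [ha_sq]; ring] at h
  refine ⟨hH, ?_, ?_, ?_⟩
  · exact squeeze_zero' (hlarge.mono hS) (hlarge.mono fun t ht => by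
      linarith [hHam t ht, hK t ht, hκρ t ht]) hexcess
  · refine squeeze_zero' (hlarge.mono hρnn) (hlarge.mono fun t ht => ?_)
      (by simpa using hexcess.div_const (2 * κ))
    rw [le_div_iff₀ (by positivity)]
    linarith [hHam t ht, hS t ht, hK t ht]
  · have h : Tendsto (fun t => -K t) atTop (nhds 0) :=
      squeeze_zero' (hlarge.mono fun t ht => neg_nonneg.2 (hK t ht))
        (hlarge.mono fun t ht => by linarith [hHam t ht, hS t ht, hκρ t ht]) hexcess
    simpa using h.neg
end

section
/- Let (H, n₁, n₂, n₃, σ₊, σ₋, ρ) be a solution of the Bianchi IX topo-GR system on an open interval I with Λ = 0, let t₀ ∈ I with ρ(t₀) ≥ 0, and suppose H(t₀) = 0. Then on all of I: H ≡ 0, σ₊ ≡ 0, σ₋ ≡ 0, ρ ≡ 0, and n₁ = n₂ = n₃ is a constant; i.e. the solution is a static vacuum solution, so recollapse and bounce are impossible for Bianchi IX models in topo-GR under the weak energy condition. -/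
open Real Filter Set Topology

/-- Two integral curves of a locally Lipschitz vector field on an open interval that agree at one
point agree everywhere. -/
theorem LocallyLipschitz.eqOn_of_hasDerivAt {E : Type*} [NormedAddCommGroup E] [NormedSpace ℝ E]
    {v : E → E} (hv : LocallyLipschitz v) {I : Set ℝ} (hIopen : IsOpen I) (hIconv : Convex ℝ I)
    {f g : ℝ → E} (hf : ∀ t ∈ I, HasDerivAt f (v (f t)) t)
    (hg : ∀ t ∈ I, HasDerivAt g (v (g t)) t) {t₀ : ℝ} (ht₀ : t₀ ∈ I) (heq : f t₀ = g t₀) :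
    EqOn f g I := by
  intro t ht
  have hmin : min t t₀ ∈ I := by rcases min_choice t t₀ with h | h <;> rwa [h]
  have hmax : max t t₀ ∈ I := by rcases max_choice t t₀ with h | h <;> rwa [h]
  obtain ⟨a, haI, ha⟩ : ∃ a ∈ I, a < min t t₀ :=
    (((hIopen.eventually_mem hmin).filter_mono nhdsWithin_le_nhds).and
      (self_mem_nhdsWithin (s := Iio (min t t₀)))).exists
  obtain ⟨b, hbI, hb⟩ : ∃ b ∈ I, max t t₀ < b :=
    (((hIopen.eventually_mem hmax).filter_mono nhdsWithin_le_nhds).and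
      (self_mem_nhdsWithin (s := Ioi (max t t₀)))).exists
  rw [lt_min_iff] at ha
  rw [max_lt_iff] at hb
  have hsub : Icc a b ⊆ I := hIconv.ordConnected.out haI hbI
  have hcompact : IsCompact (f '' Icc a b ∪ g '' Icc a b) :=
    (isCompact_Icc.image_of_continuousOn fun x hx =>
      (hf x (hsub hx)).continuousAt.continuousWithinAt).union
    (isCompact_Icc.image_of_continuousOn fun x hx =>
      (hg x (hsub hx)).continuousAt.continuousWithinAt)
  obtain ⟨K, hK⟩ := (hv.locallyLipschitzOn).exists_lipschitzOnWith_of_compact hcompact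
  refine ODE_solution_unique_of_mem_Ioo (v := fun _ => v) (fun _ _ => hK) ⟨ha.2, hb.2⟩
    (fun x hx => ?_) (fun x hx => ?_) heq ⟨ha.1, hb.1⟩
  · have hx' := Ioo_subset_Icc_self hx
    exact ⟨hf x (hsub hx'), Or.inl (mem_image_of_mem f hx')⟩
  · have hx' := Ioo_subset_Icc_self hx
    exact ⟨hg x (hsub hx'), Or.inr (mem_image_of_mem g hx')⟩

/-- The evolution equations of the Bianchi IX topo-GR system with `Λ = 0`, as a vector field in
the variables `(H, n₁, n₂, n₃, σ₊, σ₋, ρ)`. -/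
noncomputable def bianchiIXField (κ w : ℝ) :
    ℝ × ℝ × ℝ × ℝ × ℝ × ℝ × ℝ → ℝ × ℝ × ℝ × ℝ × ℝ × ℝ × ℝ :=
  fun (H, n₁, n₂, n₃, σp, σm, ρ) =>
    (-H ^ 2 - 2 * (σp ^ 2 + σm ^ 2) - κ * (1 + 3 * w) * ρ / 6,
      -n₁ * (H + 4 * σp),
      -n₂ * (H - 2 * σp - 2 * Real.sqrt 3 * σm),
      -n₃ * (H - 2 * σp + 2 * Real.sqrt 3 * σm),
      -3 * H * σp + (1 / 12) * (4 * n₁ ^ 2 - 2 * n₂ ^ 2 - 2 * n₃ ^ 2 + 2 * n₂ * n₃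
        - n₁ * n₂ - n₁ * n₃),
      -3 * H * σm - (1 / (4 * Real.sqrt 3)) * (n₃ - n₂) * (n₁ - 2 * n₂ - 2 * n₃),
      -3 * (1 + w) * H * ρ)

theorem contDiff_bianchiIXField (κ w : ℝ) : ContDiff ℝ 1 (bianchiIXField κ w) := by
  unfold bianchiIXField
  fun_prop

/-- Isotropic static vacuum states are equilibria. -/
theorem bianchiIXField_isotropic (κ w c : ℝ) :
    bianchiIXField κ w (0, c, c, c, 0, 0, 0) = 0 := by
  simp only [bianchiIXField, Prod.mk_eq_zero]
  refine ⟨?_, ?_, ?_, ?_, ?_, ?_, ?_⟩ <;> ring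

/-- A state with vanishing expansion and nonnegative energy density that satisfies the
Hamiltonian constraint is an isotropic vacuum state. -/
theorem isotropic_vacuum_of_constraint {κ n₁ n₂ n₃ σp σm ρ : ℝ} (hκ : 0 < κ) (hρ : 0 ≤ ρ)
    (h : 0 = σp ^ 2 + σm ^ 2
      + (1 / 12) * (n₁ ^ 2 + n₂ ^ 2 + n₃ ^ 2 - n₁ * n₂ - n₂ * n₃ - n₃ * n₁) + κ * ρ / 3) :
    n₂ = n₁ ∧ n₃ = n₁ ∧ σp = 0 ∧ σm = 0 ∧ ρ = 0 := by
  have hκρ : 0 ≤ κ * ρ := mul_nonneg hκ.le hρ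
  have hp := sq_nonneg σp
  have hm := sq_nonneg σm
  have h₁ := sq_nonneg (n₂ - n₁)
  have h₂ := sq_nonneg (n₃ - n₁)
  have h₃ := sq_nonneg (n₃ - n₂)
  refine ⟨sub_eq_zero.1 (sq_eq_zero_iff.1 ?_), sub_eq_zero.1 (sq_eq_zero_iff.1 ?_),
    sq_eq_zero_iff.1 ?_, sq_eq_zero_iff.1 ?_,
    (mul_eq_zero.1 (?_ : κ * ρ = 0)).resolve_left hκ.ne'⟩ <;> linarith

/-- Static vacuum property for Bianchi IX models of topo-GR: for a solution
of the Bianchi IX topo-GR system on an open interval `I` with `Λ = 0`, if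
`ρ(t₀) ≥ 0` (weak energy condition) and `H(t₀) = 0` at some `t₀ ∈ I`, then the
solution is a static vacuum solution on all of `I`: `H ≡ 0`, `σ₊ ≡ 0`,
`σ₋ ≡ 0`, `ρ ≡ 0` and `n₁ = n₂ = n₃` is constant. Hence no recollapse and no
bounce is possible. -/
theorem topoGR_BianchiIX_static_vacuum
    (κ Λ w : ℝ) (hκ : 0 < κ) (hΛ : Λ = 0)
    (I : Set ℝ) (hIopen : IsOpen I) (hIconn : Convex ℝ I)
    (H n₁ n₂ n₃ σp σm ρ : ℝ → ℝ)
    (hHam : ∀ t ∈ I, (H t) ^ 2 = (σp t) ^ 2 + (σm t) ^ 2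
      + (1 / 12) * ((n₁ t) ^ 2 + (n₂ t) ^ 2 + (n₃ t) ^ 2
        - n₁ t * n₂ t - n₂ t * n₃ t - n₃ t * n₁ t)
      + (κ * ρ t + Λ) / 3)
    (hRay : ∀ t ∈ I, HasDerivAt H
      (-(H t) ^ 2 - 2 * ((σp t) ^ 2 + (σm t) ^ 2)
        - κ * (1 + 3 * w) * ρ t / 6 + Λ / 3) t)
    (hn₁ : ∀ t ∈ I, HasDerivAt n₁ (-(n₁ t) * (H t + 4 * σp t)) t)
    (hn₂ : ∀ t ∈ I, HasDerivAt n₂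
      (-(n₂ t) * (H t - 2 * σp t - 2 * Real.sqrt 3 * σm t)) t)
    (hn₃ : ∀ t ∈ I, HasDerivAt n₃
      (-(n₃ t) * (H t - 2 * σp t + 2 * Real.sqrt 3 * σm t)) t)
    (hσp : ∀ t ∈ I, HasDerivAt σp
      (-3 * H t * σp t + (1 / 12) * (4 * (n₁ t) ^ 2 - 2 * (n₂ t) ^ 2
        - 2 * (n₃ t) ^ 2 + 2 * n₂ t * n₃ t - n₁ t * n₂ t - n₁ t * n₃ t)) t)
    (hσm : ∀ t ∈ I, HasDerivAt σm
      (-3 * H t * σm t - (1 / (4 * Real.sqrt 3)) * (n₃ t - n₂ t)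
        * (n₁ t - 2 * n₂ t - 2 * n₃ t)) t)
    (hρ : ∀ t ∈ I, HasDerivAt ρ (-3 * (1 + w) * H t * ρ t) t)
    (t₀ : ℝ) (ht₀ : t₀ ∈ I) (hρ₀ : 0 ≤ ρ t₀) (hH₀ : H t₀ = 0) :
    ∀ t ∈ I, H t = 0 ∧ σp t = 0 ∧ σm t = 0 ∧ ρ t = 0 ∧
      n₁ t = n₂ t ∧ n₂ t = n₃ t ∧ n₁ t = n₁ t₀ := by
  subst hΛ
  have hc := hHam t₀ ht₀
  rw [hH₀] at hc
  obtain ⟨h₂, h₃, hp, hm, hr⟩ := isotropic_vacuum_of_constraint (n₁ := n₁ t₀) (n₂ := n₂ t₀)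
    (n₃ := n₃ t₀) (σp := σp t₀) (σm := σm t₀) hκ hρ₀ (by linarith)
  have heq := (contDiff_bianchiIXField κ w).locallyLipschitz.eqOn_of_hasDerivAt hIopen hIconn
    (f := fun t => (H t, n₁ t, n₂ t, n₃ t, σp t, σm t, ρ t))
    (g := fun _ => (0, n₁ t₀, n₁ t₀, n₁ t₀, 0, 0, 0))
    (fun t ht => by
      have hH := hRay t ht
      rw [zero_div, add_zero] at hH
      exact hH.prodMk ((hn₁ t ht).prodMk ((hn₂ t ht).prodMk ((hn₃ t ht).prodMk
        ((hσp t ht).prodMk ((hσm t ht).prodMk (hρ t ht)))))))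
    (fun t _ => by
      rw [bianchiIXField_isotropic]
      exact hasDerivAt_const t _)
    ht₀ (by simp only [hH₀, h₂, h₃, hp, hm, hr])
  intro t ht
  have h := heq ht
  simp only [Prod.mk.injEq] at h
  obtain ⟨hH, e₁, e₂, e₃, ep, em, er⟩ := h
  exact ⟨hH, ep, em, er, e₁.trans e₂.symm, e₂.trans e₃.symm, e₁⟩
end

section
/- Let (H, n₂, n₃, σ₊, σ₋, ρ) be a solution of the Bianchi VI₀ (Sol) topo-GR system on an open interval I with Λ = 0, let t₀ ∈ I with ρ(t₀) ≥ 0, and suppose H(t₀) = 0. Then on all of I: H ≡ 0, σ₊ ≡ 0, σ₋ ≡ 0, ρ ≡ 0, and n₂ and n₃ are constants with n₂ = −n₃; i.e. the solution is a static vacuum solution, so recollapse and bounce are impossible for Bianchi VI₀ models in topo-GR under the weak energy condition. -/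
open Real Filter

/-- On a closed interval, a function vanishing at the left end with `|f'| ≤ |b f|` for a continuous
`b` vanishes identically. -/
theorem eq_zero_right_of_abs_deriv_le {f f' b : ℝ → ℝ} {c d : ℝ}
    (hb : ContinuousOn b (Set.Icc c d)) (hf : ∀ t ∈ Set.Icc c d, HasDerivAt f (f' t) t)
    (hle : ∀ t ∈ Set.Icc c d, |f' t| ≤ |b t * f t|) (hc : f c = 0) :
    ∀ t ∈ Set.Icc c d, f t = 0 := by
  obtain ⟨K, hK⟩ := isCompact_Icc.exists_bound_of_continuousOn hb
  refine eq_zero_of_abs_deriv_le_mul_abs_self_of_eq_zero_right (K := K)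
    (fun t ht => (hf t ht).continuousAt.continuousWithinAt)
    (fun t ht => (hf t (Set.Ico_subset_Icc_self ht)).hasDerivWithinAt) hc fun t ht => ?_
  have ht' := Set.Ico_subset_Icc_self ht
  calc |f' t| ≤ |b t| * |f t| := by simpa only [abs_mul] using hle t ht'
    _ ≤ K * |f t| := mul_le_mul_of_nonneg_right (hK t ht') (abs_nonneg _)

/-- On a convex set, a function vanishing at one point with `|f'| ≤ |b f|` for a continuous `b`
vanishes identically. -/
theorem Convex.eq_zero_of_abs_deriv_le {I : Set ℝ} (hI : Convex ℝ I) {f f' b : ℝ → ℝ} {t₀ : ℝ}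
    (hb : ContinuousOn b I) (hf : ∀ t ∈ I, HasDerivAt f (f' t) t)
    (hle : ∀ t ∈ I, |f' t| ≤ |b t * f t|) (ht₀ : t₀ ∈ I) (h₀ : f t₀ = 0) :
    ∀ t ∈ I, f t = 0 := by
  intro t ht
  rcases le_total t₀ t with h | h
  · have hsub : Set.Icc t₀ t ⊆ I := hI.ordConnected.out ht₀ ht
    exact eq_zero_right_of_abs_deriv_le (hb.mono hsub) (fun s hs => hf s (hsub hs))
      (fun s hs => hle s (hsub hs)) h₀ t (Set.right_mem_Icc.2 h)
  · have hmaps : ∀ s ∈ Set.Icc (-t₀) (-t), -s ∈ I := fun s hs =>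
      hI.ordConnected.out ht ht₀ ⟨le_neg.1 hs.2, neg_le.1 hs.1⟩
    have key := eq_zero_right_of_abs_deriv_le (f := fun s => f (-s)) (f' := fun s => -f' (-s))
      (b := fun s => b (-s)) (hb.comp continuous_neg.continuousOn hmaps)
      (fun s hs => by
        simpa [Function.comp_def] using (hf _ (hmaps s hs)).comp s (hasDerivAt_neg s))
      (fun s hs => by simpa only [abs_neg] using hle _ (hmaps s hs))
      (by simpa using h₀) (-t) (Set.right_mem_Icc.2 (neg_le_neg h))
    simpa using key

/-- Static vacuum property for Bianchi VI₀ (Sol) models of topo-GR: for a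
solution of the Bianchi VI₀ topo-GR system on an open interval `I` with
`Λ = 0`, if `ρ(t₀) ≥ 0` (weak energy condition) and `H(t₀) = 0` at some
`t₀ ∈ I`, then the solution is a static vacuum solution on all of `I`:
`H ≡ 0`, `σ₊ ≡ 0`, `σ₋ ≡ 0`, `ρ ≡ 0`, and `n₂`, `n₃` are constants with
`n₂ = −n₃`. Hence no recollapse and no bounce is possible. -/
theorem topoGR_BianchiVI0_static_vacuum
    (κ Λ w : ℝ) (hκ : 0 < κ) (hΛ : Λ = 0)
    (I : Set ℝ) (hIopen : IsOpen I) (hIconn : Convex ℝ I)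
    (H n₂ n₃ σp σm ρ : ℝ → ℝ)
    (hHam : ∀ t ∈ I, (H t) ^ 2 = (σp t) ^ 2 + (σm t) ^ 2
      + (1 / 12) * (n₂ t + n₃ t) ^ 2 + (κ * ρ t + Λ) / 3)
    (hRay : ∀ t ∈ I, HasDerivAt H
      (-(H t) ^ 2 - 2 * ((σp t) ^ 2 + (σm t) ^ 2)
        - κ * (1 + 3 * w) * ρ t / 6 + Λ / 3) t)
    (hn₂ : ∀ t ∈ I, HasDerivAt n₂
      (-(n₂ t) * (H t - 2 * σp t - 2 * Real.sqrt 3 * σm t)) t)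
    (hn₃ : ∀ t ∈ I, HasDerivAt n₃
      (-(n₃ t) * (H t - 2 * σp t + 2 * Real.sqrt 3 * σm t)) t)
    (hσp : ∀ t ∈ I, HasDerivAt σp
      (-3 * H t * σp t - (1 / 6) * (n₂ t + n₃ t) ^ 2) t)
    (hσm : ∀ t ∈ I, HasDerivAt σm
      (-3 * H t * σm t - (1 / (2 * Real.sqrt 3)) * ((n₂ t) ^ 2 - (n₃ t) ^ 2)) t)
    (hρ : ∀ t ∈ I, HasDerivAt ρ (-3 * (1 + w) * H t * ρ t) t)
    (t₀ : ℝ) (ht₀ : t₀ ∈ I) (hρ₀ : 0 ≤ ρ t₀) (hH₀ : H t₀ = 0) :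
    ∀ t ∈ I, H t = 0 ∧ σp t = 0 ∧ σm t = 0 ∧ ρ t = 0 ∧
      n₂ t = n₂ t₀ ∧ n₃ t = n₃ t₀ ∧ n₂ t = -(n₃ t) := by
  subst hΛ
  have hHcont : ContinuousOn H I := HasDerivAt.continuousOn hRay
  have hρ₀' : ρ t₀ = 0 := by
    have h := hHam t₀ ht₀
    rw [hH₀] at h
    have : κ * ρ t₀ ≤ 0 := by
      nlinarith [sq_nonneg (σp t₀), sq_nonneg (σm t₀), sq_nonneg (n₂ t₀ + n₃ t₀)]
    exact le_antisymm (nonpos_of_mul_nonpos_right this hκ) hρ₀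
  have hρz : ∀ t ∈ I, ρ t = 0 :=
    hIconn.eq_zero_of_abs_deriv_le (b := fun t => -3 * (1 + w) * H t)
      (continuousOn_const.mul hHcont) hρ (fun t _ => le_rfl) ht₀ hρ₀'
  have hHz : ∀ t ∈ I, H t = 0 := by
    refine hIconn.eq_zero_of_abs_deriv_le (b := fun t => 3 * H t)
      (continuousOn_const.mul hHcont) hRay (fun t ht => ?_) ht₀ hH₀
    have h := hHam t ht
    rw [hρz t ht] at h ⊢
    rw [show 3 * H t * H t = 3 * H t ^ 2 by ring, abs_of_nonneg (by positivity : 0 ≤ 3 * H t ^ 2),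
      abs_le]
    constructor <;>
      nlinarith [sq_nonneg (σp t), sq_nonneg (σm t), sq_nonneg (n₂ t + n₃ t)]
  have hz : ∀ t ∈ I, σp t = 0 ∧ σm t = 0 ∧ n₂ t + n₃ t = 0 := by
    intro t ht
    have h := hHam t ht
    rw [hρz t ht, hHz t ht] at h
    refine ⟨?_, ?_, ?_⟩ <;>
      refine pow_eq_zero_iff two_ne_zero |>.1 (le_antisymm ?_ (sq_nonneg _)) <;>
      nlinarith [sq_nonneg (σp t), sq_nonneg (σm t), sq_nonneg (n₂ t + n₃ t)]
  have hconst : ∀ n n' : ℝ → ℝ, (∀ t ∈ I, HasDerivAt n (n' t) t) → (∀ t ∈ I, n' t = 0) →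
      ∀ t ∈ I, n t = n t₀ := by
    intro n n' hn hn' t ht
    exact sub_eq_zero.1 (hIconn.eq_zero_of_abs_deriv_le (f := fun s => n s - n t₀) (b := 0)
      continuousOn_const (fun s hs => (hn s hs).sub_const _)
      (fun s hs => by simp [hn' s hs]) ht₀ (sub_self _) t ht)
  intro t ht
  obtain ⟨hp, hm, hs⟩ := hz t ht
  refine ⟨hHz t ht, hp, hm, hρz t ht, hconst n₂ _ hn₂ (fun s hs => ?_) t ht,
    hconst n₃ _ hn₃ (fun s hs => ?_) t ht, eq_neg_of_add_eq_zero_left hs⟩ <;>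
  simp [hHz s hs, hz s hs]
end

section
/- Let (H, n₁, n₂, n₃, σ₊, σ₋, ρ) be a solution of the Bianchi VIII (SL̃(2,ℝ)) topo-GR system on an open interval I with Λ = 0, let t₀ ∈ I with ρ(t₀) ≥ 0, and suppose H(t₀) = 0. Then on all of I: H ≡ 0, σ₊ ≡ 0, σ₋ ≡ 0, ρ ≡ 0, and n₁, n₂, n₃ are constants with n₁ + n₂ + n₃ = 0; i.e. the solution is a static vacuum solution, so recollapse and bounce are impossible for Bianchi VIII models in topo-GR under the weak energy condition. -/
open Real Filter

/-- A function on an interval whose derivative is dominated by a continuous multiple of the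
function itself vanishes identically as soon as it vanishes at one point. -/
theorem eq_zero_of_abs_deriv_le_mul_abs_self {I : Set ℝ} (hI : Convex ℝ I) {f f' g : ℝ → ℝ}
    (hf : ∀ t ∈ I, HasDerivAt f (f' t) t) (hg : ContinuousOn g I)
    (hbound : ∀ t ∈ I, |f' t| ≤ g t * |f t|) {t₀ : ℝ} (ht₀ : t₀ ∈ I) (hf₀ : f t₀ = 0) :
    ∀ t ∈ I, f t = 0 := by
  intro t ht
  have hmem : ∀ s ∈ Set.Icc (0 : ℝ) 1, t₀ + s * (t - t₀) ∈ I := fun s hs => by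
    simpa using hI.add_smul_sub_mem ht₀ ht hs
  have hderiv : ∀ s ∈ Set.Icc (0 : ℝ) 1, HasDerivAt (fun s => f (t₀ + s * (t - t₀)))
      (f' (t₀ + s * (t - t₀)) * (t - t₀)) s := fun s hs => by
    have hline : HasDerivAt (fun s : ℝ => t₀ + s * (t - t₀)) (t - t₀) s := by
      simpa using ((hasDerivAt_id s).mul_const (t - t₀)).const_add t₀
    exact (hf _ (hmem s hs)).comp s hline
  have hcont : ContinuousOn (fun s => g (t₀ + s * (t - t₀))) (Set.Icc 0 1) :=
    hg.comp (by fun_prop) hmem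
  obtain ⟨C, hC⟩ := isCompact_Icc.exists_bound_of_continuousOn hcont
  have hzero := eq_zero_of_abs_deriv_le_mul_abs_self_of_eq_zero_right (K := C * |t - t₀|)
    (HasDerivAt.continuousOn hderiv)
    (fun s hs => (hderiv s (Set.Ico_subset_Icc_self hs)).hasDerivWithinAt)
    (by simpa using hf₀) (fun s hs => by
      have hs' := Set.Ico_subset_Icc_self hs
      have hgC : g (t₀ + s * (t - t₀)) ≤ C := (le_abs_self _).trans (hC s hs')
      rw [norm_mul, Real.norm_eq_abs, Real.norm_eq_abs, Real.norm_eq_abs, mul_right_comm C]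
      gcongr
      exact (hbound _ (hmem s hs')).trans (by gcongr)) 1 (by simp)
  simpa using hzero

/-- A function with vanishing derivative on an interval is constant there. -/
theorem eq_of_hasDerivAt_eq_zero {I : Set ℝ} (hI : Convex ℝ I) {f f' : ℝ → ℝ}
    (hf : ∀ t ∈ I, HasDerivAt f (f' t) t) (hf' : ∀ t ∈ I, f' t = 0) {t₀ : ℝ} (ht₀ : t₀ ∈ I) :
    ∀ t ∈ I, f t = f t₀ := fun t ht =>
  sub_eq_zero.1 <| eq_zero_of_abs_deriv_le_mul_abs_self (f := fun s => f s - f t₀) (g := 0) hI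
    (fun s hs => (hf s hs).sub_const _) continuousOn_const
    (fun s hs => by simp [hf' s hs]) ht₀ (sub_self _) t ht

/-- Static vacuum property for Bianchi VIII (SL̃(2,ℝ)) models of topo-GR: for
a solution of the Bianchi VIII topo-GR system on an open interval `I` with
`Λ = 0`, if `ρ(t₀) ≥ 0` (weak energy condition) and `H(t₀) = 0` at some
`t₀ ∈ I`, then the solution is a static vacuum solution on all of `I`:
`H ≡ 0`, `σ₊ ≡ 0`, `σ₋ ≡ 0`, `ρ ≡ 0`, and `n₁`, `n₂`, `n₃` are constants with
`n₁ + n₂ + n₃ = 0`. Hence no recollapse and no bounce is possible. -/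
theorem topoGR_BianchiVIII_static_vacuum
    (κ Λ w : ℝ) (hκ : 0 < κ) (hΛ : Λ = 0)
    (I : Set ℝ) (hIopen : IsOpen I) (hIconn : Convex ℝ I)
    (H n₁ n₂ n₃ σp σm ρ : ℝ → ℝ)
    (hHam : ∀ t ∈ I, (H t) ^ 2 = (σp t) ^ 2 + (σm t) ^ 2
      + (1 / 12) * (n₁ t + n₂ t + n₃ t) ^ 2 + (κ * ρ t + Λ) / 3)
    (hRay : ∀ t ∈ I, HasDerivAt H
      (-(H t) ^ 2 - 2 * ((σp t) ^ 2 + (σm t) ^ 2)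
        - κ * (1 + 3 * w) * ρ t / 6 + Λ / 3) t)
    (hn₁ : ∀ t ∈ I, HasDerivAt n₁ (-(n₁ t) * (H t + 4 * σp t)) t)
    (hn₂ : ∀ t ∈ I, HasDerivAt n₂
      (-(n₂ t) * (H t - 2 * σp t - 2 * Real.sqrt 3 * σm t)) t)
    (hn₃ : ∀ t ∈ I, HasDerivAt n₃
      (-(n₃ t) * (H t - 2 * σp t + 2 * Real.sqrt 3 * σm t)) t)
    (hσp : ∀ t ∈ I, HasDerivAt σp
      (-3 * H t * σp t + (1 / 6) * (n₁ t + n₂ t + n₃ t)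
        * (2 * n₁ t - n₂ t - n₃ t)) t)
    (hσm : ∀ t ∈ I, HasDerivAt σm
      (-3 * H t * σm t + (1 / (2 * Real.sqrt 3)) * (n₁ t + n₂ t + n₃ t)
        * (n₃ t - n₂ t)) t)
    (hρ : ∀ t ∈ I, HasDerivAt ρ (-3 * (1 + w) * H t * ρ t) t)
    (t₀ : ℝ) (ht₀ : t₀ ∈ I) (hρ₀ : 0 ≤ ρ t₀) (hH₀ : H t₀ = 0) :
    ∀ t ∈ I, H t = 0 ∧ σp t = 0 ∧ σm t = 0 ∧ ρ t = 0 ∧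
      n₁ t = n₁ t₀ ∧ n₂ t = n₂ t₀ ∧ n₃ t = n₃ t₀ ∧
      n₁ t + n₂ t + n₃ t = 0 := by
  subst hΛ
  have hρzero₀ : ρ t₀ = 0 := by
    have h := hHam t₀ ht₀
    rw [hH₀] at h
    refine le_antisymm (le_of_mul_le_mul_left ?_ hκ) hρ₀
    linarith [sq_nonneg (σp t₀), sq_nonneg (σm t₀), sq_nonneg (n₁ t₀ + n₂ t₀ + n₃ t₀)]
  have hHcont : ContinuousOn H I := HasDerivAt.continuousOn hRay
  have hρzero : ∀ t ∈ I, ρ t = 0 :=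
    eq_zero_of_abs_deriv_le_mul_abs_self hIconn hρ
      (g := fun t => |-3 * (1 + w) * H t|) (by fun_prop)
      (fun t _ => (abs_mul _ _).le) ht₀ hρzero₀
  have hHzero : ∀ t ∈ I, H t = 0 := by
    refine eq_zero_of_abs_deriv_le_mul_abs_self hIconn hRay
      (g := fun t => 3 * |H t|) (by fun_prop) (fun t ht => ?_) ht₀ hH₀
    have h := hHam t ht
    rw [hρzero t ht] at h ⊢
    rw [mul_assoc 3, abs_mul_abs_self, abs_le]
    constructor <;>
      nlinarith [sq_nonneg (σp t), sq_nonneg (σm t), sq_nonneg (n₁ t + n₂ t + n₃ t)]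
  have hvac : ∀ t ∈ I, σp t = 0 ∧ σm t = 0 ∧ n₁ t + n₂ t + n₃ t = 0 := fun t ht => by
    have h := hHam t ht
    rw [hρzero t ht, hHzero t ht] at h
    have hp := sq_nonneg (σp t)
    have hm := sq_nonneg (σm t)
    have hn := sq_nonneg (n₁ t + n₂ t + n₃ t)
    refine ⟨?_, ?_, ?_⟩ <;> refine pow_eq_zero_iff two_ne_zero |>.1 ?_ <;> linarith
  intro t ht
  refine ⟨hHzero t ht, (hvac t ht).1, (hvac t ht).2.1, hρzero t ht,
    eq_of_hasDerivAt_eq_zero hIconn hn₁ ?_ ht₀ t ht,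
    eq_of_hasDerivAt_eq_zero hIconn hn₂ ?_ ht₀ t ht,
    eq_of_hasDerivAt_eq_zero hIconn hn₃ ?_ ht₀ t ht, (hvac t ht).2.2⟩ <;>
  · intro s hs
    simp [hHzero s hs, (hvac s hs).1, (hvac s hs).2.1]
end

section
/- Let (H, n₂, n₃, σ₊, σ₋, ρ) be a solution of the Bianchi VII₀ topo-GR system on an open interval I with Λ = 0, let t₀ ∈ I with ρ(t₀) ≥ 0, and suppose H(t₀) = 0. Then on all of I: H ≡ 0, σ₊ ≡ 0, σ₋ ≡ 0, ρ ≡ 0, and n₂ = n₃ is a constant; i.e. the solution is a static vacuum solution, so recollapse and bounce are impossible for Bianchi VII₀ models under the weak energy condition. -/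
open Real Filter

/-- A function which vanishes at the left endpoint of a compact interval and whose derivative is
bounded by a continuous multiple of the function itself vanishes at the right endpoint. -/
lemma eq_zero_of_abs_deriv_le_mul_right {f f' g : ℝ → ℝ} {a b : ℝ} (hab : a ≤ b)
    (hg : ContinuousOn g (Set.Icc a b)) (hf : ∀ t ∈ Set.Icc a b, HasDerivAt f (f' t) t)
    (hbound : ∀ t ∈ Set.Icc a b, |f' t| ≤ g t * |f t|) (ha : f a = 0) : f b = 0 := by
  obtain ⟨K, hK⟩ := isCompact_Icc.bddAbove_image hg
  refine eq_zero_of_abs_deriv_le_mul_abs_self_of_eq_zero_right (K := K) (f' := f')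
    (fun t ht => (hf t ht).continuousAt.continuousWithinAt)
    (fun t ht => (hf t (Set.Ico_subset_Icc_self ht)).hasDerivWithinAt) ha
    (fun t ht => ?_) b (Set.right_mem_Icc.2 hab)
  have ht' := Set.Ico_subset_Icc_self ht
  exact (hbound t ht').trans
    (mul_le_mul_of_nonneg_right (hK (Set.mem_image_of_mem g ht')) (abs_nonneg _))

/-- A function on a convex set which vanishes at one point and whose derivative is bounded by a
continuous multiple of the function itself vanishes identically. -/
lemma eq_zero_of_abs_deriv_le_mul {f f' g : ℝ → ℝ} {I : Set ℝ} (hI : Convex ℝ I)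
    (hg : ContinuousOn g I) (hf : ∀ t ∈ I, HasDerivAt f (f' t) t)
    (hbound : ∀ t ∈ I, |f' t| ≤ g t * |f t|) {t₀ : ℝ} (ht₀ : t₀ ∈ I) (h₀ : f t₀ = 0) :
    ∀ t ∈ I, f t = 0 := by
  intro t ht
  rcases le_total t₀ t with h | h
  · have hsub : Set.Icc t₀ t ⊆ I := hI.ordConnected.out ht₀ ht
    exact eq_zero_of_abs_deriv_le_mul_right h (hg.mono hsub) (fun s hs => hf s (hsub hs))
      (fun s hs => hbound s (hsub hs)) h₀
  · have hsub : ∀ s ∈ Set.Icc (-t₀) (-t), -s ∈ I := fun s hs =>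
      hI.ordConnected.out ht ht₀ ⟨by linarith [hs.2], by linarith [hs.1]⟩
    have key := eq_zero_of_abs_deriv_le_mul_right (f := fun s => f (-s))
      (f' := fun s => -f' (-s)) (g := fun s => g (-s)) (neg_le_neg h)
      (hg.comp continuous_neg.continuousOn hsub)
      (fun s hs => by
        simpa [Function.comp_def] using (hf (-s) (hsub s hs)).comp s (hasDerivAt_neg s))
      (fun s hs => by simpa using hbound (-s) (hsub s hs)) (by simpa using h₀)
    simpa using key

/-- Static vacuum property for Bianchi VII₀ models of topo-GR: for a solution
of the Bianchi VII₀ topo-GR system on an open interval `I` with `Λ = 0`, if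
`ρ(t₀) ≥ 0` (weak energy condition) and `H(t₀) = 0` at some `t₀ ∈ I`, then the
solution is a static vacuum solution on all of `I`: `H ≡ 0`, `σ₊ ≡ 0`,
`σ₋ ≡ 0`, `ρ ≡ 0` and `n₂ = n₃` is constant. Hence no recollapse and no
bounce is possible. -/
theorem topoGR_BianchiVII0_static_vacuum
    (κ Λ w : ℝ) (hκ : 0 < κ) (hΛ : Λ = 0)
    (I : Set ℝ) (hIopen : IsOpen I) (hIconn : Convex ℝ I)
    (H n₂ n₃ σp σm ρ : ℝ → ℝ)
    (hHam : ∀ t ∈ I, (H t) ^ 2 = (σp t) ^ 2 + (σm t) ^ 2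
      + (1 / 12) * (n₂ t - n₃ t) ^ 2 + (κ * ρ t + Λ) / 3)
    (hRay : ∀ t ∈ I, HasDerivAt H
      (-(H t) ^ 2 - 2 * ((σp t) ^ 2 + (σm t) ^ 2)
        - κ * (1 + 3 * w) * ρ t / 6 + Λ / 3) t)
    (hn₂ : ∀ t ∈ I, HasDerivAt n₂
      (-(n₂ t) * (H t - 2 * σp t - 2 * Real.sqrt 3 * σm t)) t)
    (hn₃ : ∀ t ∈ I, HasDerivAt n₃
      (-(n₃ t) * (H t - 2 * σp t + 2 * Real.sqrt 3 * σm t)) t)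
    (hσp : ∀ t ∈ I, HasDerivAt σp
      (-3 * H t * σp t - (1 / 6) * (n₂ t - n₃ t) ^ 2) t)
    (hσm : ∀ t ∈ I, HasDerivAt σm
      (-3 * H t * σm t + (1 / (2 * Real.sqrt 3)) * ((n₃ t) ^ 2 - (n₂ t) ^ 2)) t)
    (hρ : ∀ t ∈ I, HasDerivAt ρ (-3 * (1 + w) * H t * ρ t) t)
    (t₀ : ℝ) (ht₀ : t₀ ∈ I) (hρ₀ : 0 ≤ ρ t₀) (hH₀ : H t₀ = 0) :
    ∀ t ∈ I, H t = 0 ∧ σp t = 0 ∧ σm t = 0 ∧ ρ t = 0 ∧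
      n₂ t = n₃ t ∧ n₂ t = n₂ t₀ := by
  subst hΛ
  have hHc : ContinuousOn H I := fun t ht => (hRay t ht).continuousAt.continuousWithinAt
  have hρ_init : ρ t₀ = 0 := by
    have h := hHam t₀ ht₀
    rw [hH₀] at h
    have hκρ : κ * ρ t₀ ≤ 0 := by
      linarith [sq_nonneg (σp t₀), sq_nonneg (σm t₀), sq_nonneg (n₂ t₀ - n₃ t₀)]
    exact le_antisymm (nonpos_of_mul_nonpos_right hκρ hκ) hρ₀
  have hρ_zero : ∀ t ∈ I, ρ t = 0 :=
    eq_zero_of_abs_deriv_le_mul hIconn (g := fun t => |-3 * (1 + w) * H t|)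
      (continuousOn_const.mul hHc).abs hρ (fun t _ => (abs_mul _ _).le) ht₀ hρ_init
  -- In vacuum the constraint bounds the shear by `H ^ 2`, so `|H'| ≤ 3 * H ^ 2`.
  have hH_zero : ∀ t ∈ I, H t = 0 := by
    refine eq_zero_of_abs_deriv_le_mul hIconn (g := fun t => 3 * |H t|)
      (continuousOn_const.mul hHc.abs) hRay (fun t ht => ?_) ht₀ hH₀
    have h := hHam t ht
    rw [hρ_zero t ht] at h ⊢
    rw [mul_assoc 3, abs_mul_abs_self, abs_le]
    constructor <;> nlinarith [sq_nonneg (σp t), sq_nonneg (σm t), sq_nonneg (n₂ t - n₃ t)]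
  have hshear : ∀ t ∈ I, σp t = 0 ∧ σm t = 0 ∧ n₂ t = n₃ t := by
    intro t ht
    have h := hHam t ht
    rw [hρ_zero t ht, hH_zero t ht] at h
    have hp := sq_nonneg (σp t)
    have hm := sq_nonneg (σm t)
    have hd := sq_nonneg (n₂ t - n₃ t)
    exact ⟨pow_eq_zero_iff two_ne_zero |>.1 (by linarith),
      pow_eq_zero_iff two_ne_zero |>.1 (by linarith),
      sub_eq_zero.1 (pow_eq_zero_iff two_ne_zero |>.1 (by linarith))⟩
  have hn₂_const : ∀ t ∈ I, n₂ t - n₂ t₀ = 0 := by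
    refine eq_zero_of_abs_deriv_le_mul hIconn (g := fun _ => 0) continuousOn_const
      (fun t ht => (hn₂ t ht).sub_const (n₂ t₀)) (fun t ht => ?_) ht₀ (sub_self _)
    obtain ⟨hp, hm, -⟩ := hshear t ht
    simp [hH_zero t ht, hp, hm]
  intro t ht
  obtain ⟨hp, hm, hd⟩ := hshear t ht
  exact ⟨hH_zero t ht, hp, hm, hρ_zero t ht, hd, sub_eq_zero.1 (hn₂_const t ht)⟩
end

section
/- Let (H, n₁, σ₊, r₂, ρ) be a solution of the LRS Bianchi II (Nil) topo-GR system on an open interval I with Λ = 0, let t₀ ∈ I with ρ(t₀) ≥ 0 and n₁(t₀) > 0, and suppose H(t₀) = 0. Then on all of I: H ≡ 0, σ₊ ≡ 0, ρ ≡ 0, r₂ ≡ 1, and n₁ is a constant; i.e. the solution is a static vacuum solution, so recollapse and bounce are impossible for LRS Bianchi II models in topo-GR under the weak energy condition. -/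
open Real Filter

/-- A function on a convex set with `|f'| ≤ a |f|`, `a` continuous, that vanishes at one point
vanishes at every later point. -/
lemma eq_zero_of_abs_deriv_le_of_le {s : Set ℝ} (hs : Convex ℝ s) {f f' a : ℝ → ℝ}
    (hf : ∀ t ∈ s, HasDerivAt f (f' t) t) (ha : ContinuousOn a s)
    (hbound : ∀ t ∈ s, |f' t| ≤ a t * |f t|) {t₀ t : ℝ} (ht₀ : t₀ ∈ s) (ht : t ∈ s)
    (hle : t₀ ≤ t) (h₀ : f t₀ = 0) : f t = 0 := by
  have hsub : Set.Icc t₀ t ⊆ s := hs.ordConnected.out ht₀ ht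
  obtain ⟨K, hK⟩ := isCompact_Icc.bddAbove_image (ha.mono hsub)
  refine eq_zero_of_abs_deriv_le_mul_abs_self_of_eq_zero_right (f := f) (K := K) (a := t₀) (b := t)
    (fun x hx => (hf x (hsub hx)).continuousAt.continuousWithinAt)
    (fun x hx => (hf x (hsub (Set.Ico_subset_Icc_self hx))).hasDerivWithinAt)
    h₀ (fun x hx => ?_) t (Set.right_mem_Icc.2 hle)
  have hx' := Set.Ico_subset_Icc_self hx
  exact (hbound x (hsub hx')).trans
    (mul_le_mul_of_nonneg_right (hK (Set.mem_image_of_mem a hx')) (abs_nonneg _))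

/-- A function on a convex set with `|f'| ≤ a |f|`, `a` continuous, that vanishes at one point
vanishes identically. -/
lemma eq_zero_of_abs_deriv_le {s : Set ℝ} (hs : Convex ℝ s) {f f' a : ℝ → ℝ}
    (hf : ∀ t ∈ s, HasDerivAt f (f' t) t) (ha : ContinuousOn a s)
    (hbound : ∀ t ∈ s, |f' t| ≤ a t * |f t|) {t₀ t : ℝ} (ht₀ : t₀ ∈ s) (ht : t ∈ s)
    (h₀ : f t₀ = 0) : f t = 0 := by
  rcases le_total t₀ t with hle | hle
  · exact eq_zero_of_abs_deriv_le_of_le hs hf ha hbound ht₀ ht hle h₀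
  · have key := eq_zero_of_abs_deriv_le_of_le (s := -s) (f := fun x => f (-x))
      (f' := fun x => -f' (-x)) (a := fun x => a (-x)) (t₀ := -t₀) (t := -t) hs.neg
      (fun x hx => by simpa [Function.comp_def] using (hf (-x) hx).comp x (hasDerivAt_neg x))
      (ha.comp continuous_neg.continuousOn fun x hx => hx)
      (fun x hx => by simpa using hbound (-x) hx)
      (by simpa using ht₀) (by simpa using ht) (neg_le_neg hle) (by simpa using h₀)
    simpa using key

/-- Static vacuum property for LRS Bianchi II (Nil) models of topo-GR: for a
solution of the LRS Bianchi II topo-GR system on an open interval `I` with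
`Λ = 0` and `r₂ > 0` on `I`, if `ρ(t₀) ≥ 0` (weak energy condition),
`n₁(t₀) > 0` and `H(t₀) = 0` at some `t₀ ∈ I`, then the solution is a static
vacuum solution on all of `I`: `H ≡ 0`, `σ₊ ≡ 0`, `ρ ≡ 0`, `r₂ ≡ 1` and `n₁`
is constant. Hence no recollapse and no bounce is possible. -/
theorem topoGR_LRS_BianchiII_static_vacuum
    (κ Λ w : ℝ) (hκ : 0 < κ) (hΛ : Λ = 0)
    (I : Set ℝ) (hIopen : IsOpen I) (hIconn : Convex ℝ I)
    (H n₁ σp r₂ ρ : ℝ → ℝ)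
    (hr₂pos : ∀ t ∈ I, 0 < r₂ t)
    (hHam : ∀ t ∈ I, (H t) ^ 2 = (σp t) ^ 2
      + (1 / 12) * (n₁ t) ^ 2 * (r₂ t - 1) ^ 2 + (κ * ρ t + Λ) / 3)
    (hRay : ∀ t ∈ I, HasDerivAt H
      (-(H t) ^ 2 - 2 * (σp t) ^ 2 - κ * (1 + 3 * w) * ρ t / 6 + Λ / 3) t)
    (hn₁ : ∀ t ∈ I, HasDerivAt n₁ (-(n₁ t) * (H t + 4 * σp t)) t)
    (hσp : ∀ t ∈ I, HasDerivAt σp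
      (-3 * H t * σp t - ((n₁ t) ^ 2 / 6) * (r₂ t + 2) * (r₂ t - 1)) t)
    (hr₂ : ∀ t ∈ I, HasDerivAt r₂ (6 * r₂ t * σp t) t)
    (hρ : ∀ t ∈ I, HasDerivAt ρ (-3 * (1 + w) * H t * ρ t) t)
    (t₀ : ℝ) (ht₀ : t₀ ∈ I) (hρ₀ : 0 ≤ ρ t₀) (hn₁₀ : 0 < n₁ t₀)
    (hH₀ : H t₀ = 0) :
    ∀ t ∈ I, H t = 0 ∧ σp t = 0 ∧ ρ t = 0 ∧ r₂ t = 1 ∧ n₁ t = n₁ t₀ := by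
  subst hΛ
  have hHam₀ := hHam t₀ ht₀
  have hκρ₀ : 0 ≤ κ * ρ t₀ := mul_nonneg hκ.le hρ₀
  have hshape₀ : 0 ≤ (1 / 12) * (n₁ t₀) ^ 2 * (r₂ t₀ - 1) ^ 2 := by positivity
  rw [hH₀] at hHam₀
  have hρt₀ : ρ t₀ = 0 := by
    have : κ * ρ t₀ = 0 := by nlinarith [sq_nonneg (σp t₀)]
    exact (mul_eq_zero.1 this).resolve_left hκ.ne'
  have hr₂t₀ : r₂ t₀ = 1 := by
    have : (1 / 12) * (n₁ t₀) ^ 2 * (r₂ t₀ - 1) ^ 2 = 0 := by nlinarith [sq_nonneg (σp t₀)]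
    have : (r₂ t₀ - 1) ^ 2 = 0 := (mul_eq_zero.1 this).resolve_left (by positivity)
    exact sub_eq_zero.1 (pow_eq_zero_iff two_ne_zero |>.1 this)
  have hHcont : ContinuousOn H I := fun t ht => (hRay t ht).continuousAt.continuousWithinAt
  have hρzero : ∀ t ∈ I, ρ t = 0 := fun t ht =>
    eq_zero_of_abs_deriv_le (a := fun x => |-3 * (1 + w) * H x|) hIconn hρ
      (continuousOn_const.mul hHcont).abs (fun x _ => (abs_mul _ _).le) ht₀ ht hρt₀
  have hHzero : ∀ t ∈ I, H t = 0 := fun t ht =>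
    eq_zero_of_abs_deriv_le (a := fun x => 3 * |H x|) hIconn hRay
      (continuousOn_const.mul hHcont.abs) (fun x hx => by
        have hx' := hHam x hx
        have hshape : 0 ≤ (1 / 12) * (n₁ x) ^ 2 * (r₂ x - 1) ^ 2 := by positivity
        rw [hρzero x hx] at hx' ⊢
        rw [mul_assoc 3, abs_mul_abs_self, abs_le]
        constructor <;> nlinarith [sq_nonneg (σp x), sq_nonneg (H x)]) ht₀ ht hH₀
  have hσzero : ∀ t ∈ I, σp t = 0 := fun t ht => by
    have ht' := hHam t ht
    have hshape : 0 ≤ (1 / 12) * (n₁ t) ^ 2 * (r₂ t - 1) ^ 2 := by positivity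
    rw [hρzero t ht, hHzero t ht] at ht'
    exact pow_eq_zero_iff two_ne_zero |>.1 (by nlinarith [sq_nonneg (σp t)])
  have hconst : ∀ f f' : ℝ → ℝ, (∀ t ∈ I, HasDerivAt f (f' t) t) → (∀ t ∈ I, f' t = 0) →
      ∀ t ∈ I, f t = f t₀ := fun f f' hf hf' t ht =>
    sub_eq_zero.1 <| eq_zero_of_abs_deriv_le (f := fun x => f x - f t₀) (a := fun _ => 0) hIconn
      (fun x hx => (hf x hx).sub_const _) continuousOn_const
      (fun x hx => by simp [hf' x hx]) ht₀ ht (sub_self _)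
  intro t ht
  refine ⟨hHzero t ht, hσzero t ht, hρzero t ht, ?_, ?_⟩
  · exact (hconst r₂ _ hr₂ (fun x hx => by simp [hσzero x hx]) t ht).trans hr₂t₀
  · exact hconst n₁ _ hn₁ (fun x hx => by simp [hσzero x hx, hHzero x hx]) t ht
end

section
/- Let (H, n₁, n₂, n₃, σ₊, σ₋, ρ) be a solution of the Bianchi IX topo-GR system on an interval containing [t₀,∞), with Λ > 0, 1 + 3w ≥ 0, ρ(t) ≥ 0 for all t ≥ t₀, and H(t₀) > 0. Then H(t) ≥ √(Λ/3) for all t ≥ t₀, and as t → ∞: H(t) → √(Λ/3), σ₊(t) → 0, σ₋(t) → 0, ρ(t) → 0, and n₁(t) − n₂(t) → 0, n₂(t) − n₃(t) → 0, n₃(t) − n₁(t) → 0. In particular, a positive cosmological constant isotropizes Bianchi IX (S³-topology) solutions of topo-GR without any fine-tuning, in contrast with general relativity. -/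
open Real Filter

/-- A continuous function on `[a, ∞)` that is positive at `a` and whose square is bounded below by
`h ^ 2 > 0` stays above `h`. -/
lemma le_of_sq_le_sq_of_pos_left {f : ℝ → ℝ} {a h : ℝ} (hf : ContinuousOn f (Set.Ici a))
    (hh : 0 < h) (hsq : ∀ t ≥ a, h ^ 2 ≤ f t ^ 2) (ha : 0 < f a) {t : ℝ} (ht : a ≤ t) :
    h ≤ f t := by
  have hpos : 0 < f t := by
    by_contra! hneg
    obtain ⟨s, hs, hs0⟩ := intermediate_value_Icc' ht
      (hf.mono Set.Icc_subset_Ici_self) ⟨hneg, ha.le⟩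
    have := hsq s hs.1
    rw [hs0] at this
    nlinarith
  exact le_of_sq_le_sq (hsq t ht) hpos.le

/-- A nonnegative function satisfying `u' ≤ -c u` with `c > 0` tends to zero at infinity. -/
lemma tendsto_zero_of_hasDerivAt_le_neg_mul {u u' : ℝ → ℝ} {a c : ℝ} (hc : 0 < c)
    (hu : ∀ t ≥ a, HasDerivAt u (u' t) t) (hle : ∀ t ≥ a, u' t ≤ -c * u t)
    (hnn : ∀ t ≥ a, 0 ≤ u t) : Tendsto u atTop (nhds 0) := by
  have hderiv : ∀ t ≥ a, HasDerivAt (fun s => u s * exp (c * s))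
      (u' t * exp (c * t) + u t * (exp (c * t) * (c * 1))) t := fun t ht =>
    (hu t ht).mul ((hasDerivAt_id t).const_mul c).exp
  have hanti : AntitoneOn (fun s => u s * exp (c * s)) (Set.Ici a) := by
    refine antitoneOn_of_hasDerivWithinAt_nonpos (convex_Ici a)
      (fun t ht => (hderiv t ht).continuousAt.continuousWithinAt)
      (fun t ht => (hderiv t (interior_subset ht)).hasDerivWithinAt) (fun t ht => ?_)
    have := hle t (interior_subset ht)
    have := exp_pos (c * t)
    nlinarith
  have hlim : Tendsto (fun t => u a * exp (c * a) * exp (-(c * t))) atTop (nhds 0) := by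
    simpa using (tendsto_exp_neg_atTop_nhds_zero.comp
      (tendsto_id.const_mul_atTop hc)).const_mul (u a * exp (c * a))
  refine tendsto_of_tendsto_of_tendsto_of_le_of_le' tendsto_const_nhds hlim
    ((eventually_ge_atTop a).mono hnn) ((eventually_ge_atTop a).mono fun t ht => ?_)
  have := hanti Set.self_mem_Ici ht ht
  rwa [exp_neg, ← div_eq_mul_inv, le_div_iff₀ (exp_pos _)]

/-- If `f ^ 2 ≤ C * g` eventually and `g` tends to zero, then so does `f`. -/
lemma tendsto_zero_of_sq_le_mul {α : Type*} {l : Filter α} {f g : α → ℝ} (C : ℝ)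
    (hg : Tendsto g l (nhds 0)) (hle : ∀ᶠ t in l, f t ^ 2 ≤ C * g t) :
    Tendsto f l (nhds 0) := by
  have hsq : Tendsto (fun t => f t ^ 2) l (nhds 0) :=
    tendsto_of_tendsto_of_tendsto_of_le_of_le' tendsto_const_nhds
      (by simpa using hg.const_mul C) (Eventually.of_forall fun t => sq_nonneg (f t)) hle
  have habs : Tendsto (fun t => |f t|) l (nhds 0) := by
    simpa [sqrt_sq_eq_abs] using hsq.sqrt
  exact (tendsto_zero_iff_abs_tendsto_zero f).2 habs

/-- Isotropization of Bianchi IX (S³-topology) solutions of topo-GR by a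
positive cosmological constant: for a solution of the Bianchi IX topo-GR
system on `[t₀,∞)` with `Λ > 0`, `1 + 3w ≥ 0`, `ρ ≥ 0` and `H(t₀) > 0`,
one has `H(t) ≥ √(Λ/3)` for all `t ≥ t₀`, and as `t → ∞`: `H → √(Λ/3)`,
`σ₊ → 0`, `σ₋ → 0`, `ρ → 0`, and `n₁ − n₂ → 0`, `n₂ − n₃ → 0`,
`n₃ − n₁ → 0`. -/
theorem topoGR_BianchiIX_isotropization
    (κ Λ w t₀ : ℝ) (hκ : 0 < κ) (hΛ : 0 < Λ) (hw : 0 ≤ 1 + 3 * w)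
    (H n₁ n₂ n₃ σp σm ρ : ℝ → ℝ)
    (hHam : ∀ t ≥ t₀, (H t) ^ 2 = (σp t) ^ 2 + (σm t) ^ 2
      + (1 / 12) * ((n₁ t) ^ 2 + (n₂ t) ^ 2 + (n₃ t) ^ 2
        - n₁ t * n₂ t - n₂ t * n₃ t - n₃ t * n₁ t)
      + (κ * ρ t + Λ) / 3)
    (hRay : ∀ t ≥ t₀, HasDerivAt H
      (-(H t) ^ 2 - 2 * ((σp t) ^ 2 + (σm t) ^ 2)
        - κ * (1 + 3 * w) * ρ t / 6 + Λ / 3) t)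
    (hn₁ : ∀ t ≥ t₀, HasDerivAt n₁ (-(n₁ t) * (H t + 4 * σp t)) t)
    (hn₂ : ∀ t ≥ t₀, HasDerivAt n₂
      (-(n₂ t) * (H t - 2 * σp t - 2 * Real.sqrt 3 * σm t)) t)
    (hn₃ : ∀ t ≥ t₀, HasDerivAt n₃
      (-(n₃ t) * (H t - 2 * σp t + 2 * Real.sqrt 3 * σm t)) t)
    (hσp : ∀ t ≥ t₀, HasDerivAt σp
      (-3 * H t * σp t + (1 / 12) * (4 * (n₁ t) ^ 2 - 2 * (n₂ t) ^ 2
        - 2 * (n₃ t) ^ 2 + 2 * n₂ t * n₃ t - n₁ t * n₂ t - n₁ t * n₃ t)) t)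
    (hσm : ∀ t ≥ t₀, HasDerivAt σm
      (-3 * H t * σm t - (1 / (4 * Real.sqrt 3)) * (n₃ t - n₂ t)
        * (n₁ t - 2 * n₂ t - 2 * n₃ t)) t)
    (hρ : ∀ t ≥ t₀, HasDerivAt ρ (-3 * (1 + w) * H t * ρ t) t)
    (hρnn : ∀ t ≥ t₀, 0 ≤ ρ t) (hH₀ : 0 < H t₀) :
    (∀ t ≥ t₀, Real.sqrt (Λ / 3) ≤ H t) ∧
    Tendsto H atTop (nhds (Real.sqrt (Λ / 3))) ∧
    Tendsto σp atTop (nhds 0) ∧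
    Tendsto σm atTop (nhds 0) ∧
    Tendsto ρ atTop (nhds 0) ∧
    Tendsto (fun t => n₁ t - n₂ t) atTop (nhds 0) ∧
    Tendsto (fun t => n₂ t - n₃ t) atTop (nhds 0) ∧
    Tendsto (fun t => n₃ t - n₁ t) atTop (nhds 0) := by
  set h := √(Λ / 3)
  have hh : 0 < h := sqrt_pos.2 (by positivity)
  have hh2 : h ^ 2 = Λ / 3 := sq_sqrt (by positivity)
  have hsum : ∀ t ≥ t₀, H t ^ 2 - h ^ 2 = σp t ^ 2 + σm t ^ 2
      + ((n₁ t - n₂ t) ^ 2 + (n₂ t - n₃ t) ^ 2 + (n₃ t - n₁ t) ^ 2) / 24 + κ * ρ t / 3 := by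
    intro t ht
    rw [hHam t ht, hh2]
    ring
  have hκρ : ∀ t ≥ t₀, 0 ≤ κ * ρ t := fun t ht => mul_nonneg hκ.le (hρnn t ht)
  have hlow : ∀ t ≥ t₀, h ≤ H t := fun t ht =>
    le_of_sq_le_sq_of_pos_left (fun s hs => (hRay s hs).continuousAt.continuousWithinAt) hh
      (fun s hs => by
        have := hsum s hs
        have := hκρ s hs
        nlinarith [sq_nonneg (σp s), sq_nonneg (σm s), sq_nonneg (n₁ s - n₂ s),
          sq_nonneg (n₂ s - n₃ s), sq_nonneg (n₃ s - n₁ s)]) hH₀ ht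
  have hdecay : Tendsto (fun t => H t - h) atTop (nhds 0) := by
    refine tendsto_zero_of_hasDerivAt_le_neg_mul (a := t₀) (c := 2 * h) (by positivity)
      (fun t ht => (hRay t ht).sub_const h) (fun t ht => ?_)
      (fun t ht => sub_nonneg.2 (hlow t ht))
    have := mul_nonneg hw (hκρ t ht)
    nlinarith [sq_nonneg (σp t), sq_nonneg (σm t), sq_nonneg (H t - h)]
  have hHlim : Tendsto H atTop (nhds h) := by simpa using hdecay.add_const h
  have hgap : Tendsto (fun t => H t ^ 2 - h ^ 2) atTop (nhds 0) := by
    rw [← sub_self (h ^ 2)]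
    exact (hHlim.pow 2).sub_const (h ^ 2)
  have hzero : ∀ f : ℝ → ℝ, (∀ t ≥ t₀, f t ^ 2 ≤ 24 * (H t ^ 2 - h ^ 2)) →
      Tendsto f atTop (nhds 0) := fun f hf =>
    tendsto_zero_of_sq_le_mul 24 hgap ((eventually_ge_atTop t₀).mono hf)
  have hρlim : Tendsto ρ atTop (nhds 0) := by
    refine tendsto_of_tendsto_of_tendsto_of_le_of_le' tendsto_const_nhds
      (by simpa using hgap.const_mul (3 / κ)) ((eventually_ge_atTop t₀).mono hρnn)
      ((eventually_ge_atTop t₀).mono fun t ht => ?_)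
    rw [div_mul_eq_mul_div, le_div_iff₀ hκ, hsum t ht]
    nlinarith [sq_nonneg (σp t), sq_nonneg (σm t), sq_nonneg (n₁ t - n₂ t),
      sq_nonneg (n₂ t - n₃ t), sq_nonneg (n₃ t - n₁ t)]
  refine ⟨hlow, hHlim, hzero _ ?_, hzero _ ?_, hρlim, hzero _ ?_, hzero _ ?_, hzero _ ?_⟩ <;>
  · intro t ht
    rw [hsum t ht]
    linarith [hκρ t ht, sq_nonneg (σp t), sq_nonneg (σm t), sq_nonneg (n₁ t - n₂ t),
      sq_nonneg (n₂ t - n₃ t), sq_nonneg (n₃ t - n₁ t)]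
end

section
/- Let (H, n₁, n₂, n₃, σ₊, σ₋, ρ) be a solution of the Bianchi VIII (SL̃(2,ℝ)) topo-GR system on an interval containing [t₀,∞), with Λ > 0, 1 + 3w ≥ 0, ρ(t) ≥ 0 for all t ≥ t₀, and H(t₀) > 0. Then H(t) ≥ √(Λ/3) for all t ≥ t₀, and as t → ∞: H(t) → √(Λ/3), σ₊(t) → 0, σ₋(t) → 0, ρ(t) → 0, and n₁(t) + n₂(t) + n₃(t) → 0; i.e. a positive cosmological constant isotropizes Bianchi VIII solutions of topo-GR. -/
open Real Filter

/-- A nonnegative function with `f' ≤ -c f` on `[t₀, ∞)` for some `c > 0` tends to `0`. -/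
theorem tendsto_zero_of_hasDerivAt_le_neg_mul_s9 {f f' : ℝ → ℝ} {c t₀ : ℝ} (hc : 0 < c)
    (hf : ∀ t ≥ t₀, HasDerivAt f (f' t) t) (hf' : ∀ t ≥ t₀, f' t ≤ -c * f t)
    (hnn : ∀ t ≥ t₀, 0 ≤ f t) : Tendsto f atTop (nhds 0) := by
  have hg : ∀ t ≥ t₀, HasDerivAt (fun s => f s * exp (c * s))
      (f' t * exp (c * t) + f t * (exp (c * t) * (c * 1))) t := fun t ht =>
    (hf t ht).mul (((hasDerivAt_id t).const_mul c).exp)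
  have hanti : AntitoneOn (fun s => f s * exp (c * s)) (Set.Ici t₀) := by
    refine antitoneOn_of_deriv_nonpos (convex_Ici t₀)
      (fun t ht => (hg t ht).continuousAt.continuousWithinAt)
      (fun t ht => (hg t (interior_subset ht)).differentiableAt.differentiableWithinAt)
      fun t ht => ?_
    have ht' : t ≥ t₀ := interior_subset ht
    rw [(hg t ht').deriv]
    nlinarith [hf' t ht', exp_pos (c * t)]
  have hlim : Tendsto (fun t => f t₀ * exp (c * t₀) * exp (-(c * t))) atTop (nhds 0) := by
    have h := (tendsto_exp_neg_atTop_nhds_zero.comp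
      (tendsto_id.const_mul_atTop hc)).const_mul (f t₀ * exp (c * t₀))
    simpa using h
  refine tendsto_of_tendsto_of_tendsto_of_le_of_le' tendsto_const_nhds hlim
    ((eventually_ge_atTop t₀).mono hnn) ((eventually_ge_atTop t₀).mono fun t ht => ?_)
  have h : f t * exp (c * t) ≤ f t₀ * exp (c * t₀) :=
    hanti Set.self_mem_Ici ht ht
  rw [exp_neg, ← div_eq_mul_inv, le_div_iff₀ (exp_pos _)]
  exact h

/-- A function whose square is eventually bounded by a function tending to `0` tends to `0`. -/
theorem tendsto_zero_of_sq_le {α : Type*} {l : Filter α} {f g : α → ℝ}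
    (hg : Tendsto g l (nhds 0)) (h : ∀ᶠ t in l, f t ^ 2 ≤ g t) : Tendsto f l (nhds 0) := by
  have hs : Tendsto (fun t => √(g t)) l (nhds 0) := by
    simpa using hg.sqrt
  exact squeeze_zero_norm' (h.mono fun t ht => abs_le_sqrt ht) hs

/-- Isotropization of Bianchi VIII (SL̃(2,ℝ)) solutions of topo-GR by a
positive cosmological constant: for a solution of the Bianchi VIII topo-GR
system on `[t₀,∞)` with `Λ > 0`, `1 + 3w ≥ 0`, `ρ ≥ 0` and `H(t₀) > 0`,
one has `H(t) ≥ √(Λ/3)` for all `t ≥ t₀`, and as `t → ∞`: `H → √(Λ/3)`,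
`σ₊ → 0`, `σ₋ → 0`, `ρ → 0`, and `n₁ + n₂ + n₃ → 0`. -/
theorem topoGR_BianchiVIII_isotropization
    (κ Λ w t₀ : ℝ) (hκ : 0 < κ) (hΛ : 0 < Λ) (hw : 0 ≤ 1 + 3 * w)
    (H n₁ n₂ n₃ σp σm ρ : ℝ → ℝ)
    (hHam : ∀ t ≥ t₀, (H t) ^ 2 = (σp t) ^ 2 + (σm t) ^ 2
      + (1 / 12) * (n₁ t + n₂ t + n₃ t) ^ 2 + (κ * ρ t + Λ) / 3)
    (hRay : ∀ t ≥ t₀, HasDerivAt H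
      (-(H t) ^ 2 - 2 * ((σp t) ^ 2 + (σm t) ^ 2)
        - κ * (1 + 3 * w) * ρ t / 6 + Λ / 3) t)
    (hn₁ : ∀ t ≥ t₀, HasDerivAt n₁ (-(n₁ t) * (H t + 4 * σp t)) t)
    (hn₂ : ∀ t ≥ t₀, HasDerivAt n₂
      (-(n₂ t) * (H t - 2 * σp t - 2 * Real.sqrt 3 * σm t)) t)
    (hn₃ : ∀ t ≥ t₀, HasDerivAt n₃
      (-(n₃ t) * (H t - 2 * σp t + 2 * Real.sqrt 3 * σm t)) t)
    (hσp : ∀ t ≥ t₀, HasDerivAt σp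
      (-3 * H t * σp t + (1 / 6) * (n₁ t + n₂ t + n₃ t)
        * (2 * n₁ t - n₂ t - n₃ t)) t)
    (hσm : ∀ t ≥ t₀, HasDerivAt σm
      (-3 * H t * σm t + (1 / (2 * Real.sqrt 3)) * (n₁ t + n₂ t + n₃ t)
        * (n₃ t - n₂ t)) t)
    (hρ : ∀ t ≥ t₀, HasDerivAt ρ (-3 * (1 + w) * H t * ρ t) t)
    (hρnn : ∀ t ≥ t₀, 0 ≤ ρ t) (hH₀ : 0 < H t₀) :
    (∀ t ≥ t₀, Real.sqrt (Λ / 3) ≤ H t) ∧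
    Tendsto H atTop (nhds (Real.sqrt (Λ / 3))) ∧
    Tendsto σp atTop (nhds 0) ∧
    Tendsto σm atTop (nhds 0) ∧
    Tendsto ρ atTop (nhds 0) ∧
    Tendsto (fun t => n₁ t + n₂ t + n₃ t) atTop (nhds 0) := by
  obtain ⟨a, ha⟩ : ∃ a, a = √(Λ / 3) := ⟨_, rfl⟩
  have ha₀ : 0 < a := ha ▸ sqrt_pos.2 (by positivity)
  have ha₂ : a ^ 2 = Λ / 3 := ha ▸ sq_sqrt (by positivity)
  rw [← ha]
  have hκρ : ∀ t ≥ t₀, 0 ≤ κ * ρ t := fun t ht => mul_nonneg hκ.le (hρnn t ht)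
  have hHsq : ∀ t ≥ t₀, a ^ 2 ≤ H t ^ 2 := fun t ht => by
    nlinarith [hHam t ht, hκρ t ht, sq_nonneg (σp t), sq_nonneg (σm t),
      sq_nonneg (n₁ t + n₂ t + n₃ t)]
  have hHpos : ∀ t ≥ t₀, 0 < H t := fun t ht => by
    by_contra! hneg
    obtain ⟨s, hs, hs₀⟩ := intermediate_value_Icc' ht
      (fun s hs => (hRay s hs.1).continuousAt.continuousWithinAt) ⟨hneg, hH₀.le⟩
    nlinarith [hHsq s hs.1]
  have hHge : ∀ t ≥ t₀, a ≤ H t := fun t ht =>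
    le_of_sq_le_sq (hHsq t ht) (hHpos t ht).le
  have hsub : Tendsto (fun t => H t - a) atTop (nhds 0) := by
    refine tendsto_zero_of_hasDerivAt_le_neg_mul_s9 (c := 2 * a) (by positivity)
      (fun t ht => (hRay t ht).sub_const a) (fun t ht => ?_)
      fun t ht => sub_nonneg.2 (hHge t ht)
    have hp : 0 ≤ κ * ρ t * (1 + 3 * w) := mul_nonneg (hκρ t ht) hw
    nlinarith [sq_nonneg (H t - a), sq_nonneg (σp t), sq_nonneg (σm t)]
  have hlim : Tendsto H atTop (nhds a) := by
    simpa using hsub.add_const a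
  have hX : Tendsto (fun t => H t ^ 2 - a ^ 2) atTop (nhds 0) := by
    rw [← sub_self (a ^ 2)]
    exact (hlim.pow 2).sub_const (a ^ 2)
  have hev := eventually_ge_atTop t₀
  refine ⟨hHge, hlim, tendsto_zero_of_sq_le hX (hev.mono fun t ht => ?_),
    tendsto_zero_of_sq_le hX (hev.mono fun t ht => ?_), ?_,
    tendsto_zero_of_sq_le (g := fun t => 12 * (H t ^ 2 - a ^ 2))
      (by simpa using hX.const_mul 12) (hev.mono fun t ht => ?_)⟩
  · nlinarith [hHam t ht, hκρ t ht, sq_nonneg (σm t), sq_nonneg (n₁ t + n₂ t + n₃ t)]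
  · nlinarith [hHam t ht, hκρ t ht, sq_nonneg (σp t), sq_nonneg (n₁ t + n₂ t + n₃ t)]
  · refine tendsto_of_tendsto_of_tendsto_of_le_of_le' tendsto_const_nhds
      (by simpa using hX.const_mul (3 / κ)) (hev.mono hρnn) (hev.mono fun t ht => ?_)
    rw [div_mul_eq_mul_div, le_div_iff₀ hκ]
    nlinarith [hHam t ht, sq_nonneg (σp t), sq_nonneg (σm t),
      sq_nonneg (n₁ t + n₂ t + n₃ t)]
  · nlinarith [hHam t ht, hκρ t ht, sq_nonneg (σp t), sq_nonneg (σm t)]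
end

section
/- Let (H, n₁, n₂, n₃, σ₊, σ₋, ρ) be a solution of the Bianchi IX topo-GR system on an open interval I with n₁ > 0, n₂ > 0, n₃ > 0 on I, and suppose the solution is shear-free, i.e. σ₊ ≡ 0 and σ₋ ≡ 0 on I. Then n₁ = n₂ = n₃ on I (the spatial metric is the maximal, isotropic metric) and the expansion satisfies the flat-Friedmann constraint H² = (κρ + Λ)/3 on I. Thus shear-free perfect-fluid Bianchi IX solutions of topo-GR exist and have exactly the dynamics of a flat FLRW model of general relativity. -/
open Real Filter

/-- If the curvature terms driving both shear components vanish at positive `a, b, c`,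
then `a = b = c`. -/
theorem eq_of_shear_source_eq_zero {a b c : ℝ} (ha : 0 < a) (hb : 0 < b) (hc : 0 < c)
    (hp : 4 * a ^ 2 - 2 * b ^ 2 - 2 * c ^ 2 + 2 * b * c - a * b - a * c = 0)
    (hm : (c - b) * (a - 2 * b - 2 * c) = 0) : a = b ∧ b = c := by
  rcases mul_eq_zero.mp hm with h | h
  · obtain rfl : c = b := by linarith
    have h' : (2 * a + c) * (a - c) = 0 := by linarith
    rcases mul_eq_zero.mp h' with h' | h'
    · linarith
    · exact ⟨by linarith, rfl⟩
  · obtain rfl : a = 2 * b + 2 * c := by linarith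
    nlinarith [mul_pos hb hc, mul_pos hb hb, mul_pos hc hc]

/-- A function vanishing on an open set has zero derivative there. -/
theorem HasDerivAt.eq_zero_of_forall_mem_eq_zero {f : ℝ → ℝ} {f' t : ℝ} {s : Set ℝ}
    (hf : HasDerivAt f f' t) (hs : IsOpen s) (ht : t ∈ s) (h : ∀ x ∈ s, f x = 0) : f' = 0 :=
  hf.unique <| (hasDerivAt_const t (0 : ℝ)).congr_of_eventuallyEq <|
    Filter.eventually_of_mem (hs.mem_nhds ht) h

/-- Shear-free Bianchi IX solutions of topo-GR: for a solution of the
Bianchi IX topo-GR system on an open interval `I` with `n₁, n₂, n₃ > 0`,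
if `σ₊ ≡ 0` and `σ₋ ≡ 0` on `I`, then `n₁ = n₂ = n₃` on `I` (the spatial
metric is the maximal, isotropic one) and the expansion satisfies the
flat-Friedmann constraint `H² = (κρ + Λ)/3` on `I`, i.e. the dynamics is
exactly that of a flat FLRW model of general relativity. -/
theorem topoGR_BianchiIX_shear_free
    (κ Λ w : ℝ) (hκ : 0 < κ)
    (I : Set ℝ) (hIopen : IsOpen I) (hIconn : Convex ℝ I)
    (H n₁ n₂ n₃ σp σm ρ : ℝ → ℝ)
    (hn₁pos : ∀ t ∈ I, 0 < n₁ t)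
    (hn₂pos : ∀ t ∈ I, 0 < n₂ t)
    (hn₃pos : ∀ t ∈ I, 0 < n₃ t)
    (hHam : ∀ t ∈ I, (H t) ^ 2 = (σp t) ^ 2 + (σm t) ^ 2
      + (1 / 12) * ((n₁ t) ^ 2 + (n₂ t) ^ 2 + (n₃ t) ^ 2
        - n₁ t * n₂ t - n₂ t * n₃ t - n₃ t * n₁ t)
      + (κ * ρ t + Λ) / 3)
    (hRay : ∀ t ∈ I, HasDerivAt H
      (-(H t) ^ 2 - 2 * ((σp t) ^ 2 + (σm t) ^ 2)
        - κ * (1 + 3 * w) * ρ t / 6 + Λ / 3) t)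
    (hn₁ : ∀ t ∈ I, HasDerivAt n₁ (-(n₁ t) * (H t + 4 * σp t)) t)
    (hn₂ : ∀ t ∈ I, HasDerivAt n₂
      (-(n₂ t) * (H t - 2 * σp t - 2 * Real.sqrt 3 * σm t)) t)
    (hn₃ : ∀ t ∈ I, HasDerivAt n₃
      (-(n₃ t) * (H t - 2 * σp t + 2 * Real.sqrt 3 * σm t)) t)
    (hσp : ∀ t ∈ I, HasDerivAt σp
      (-3 * H t * σp t + (1 / 12) * (4 * (n₁ t) ^ 2 - 2 * (n₂ t) ^ 2
        - 2 * (n₃ t) ^ 2 + 2 * n₂ t * n₃ t - n₁ t * n₂ t - n₁ t * n₃ t)) t)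
    (hσm : ∀ t ∈ I, HasDerivAt σm
      (-3 * H t * σm t - (1 / (4 * Real.sqrt 3)) * (n₃ t - n₂ t)
        * (n₁ t - 2 * n₂ t - 2 * n₃ t)) t)
    (hρ : ∀ t ∈ I, HasDerivAt ρ (-3 * (1 + w) * H t * ρ t) t)
    (hshearfree : ∀ t ∈ I, σp t = 0 ∧ σm t = 0) :
    ∀ t ∈ I, n₁ t = n₂ t ∧ n₂ t = n₃ t ∧
      (H t) ^ 2 = (κ * ρ t + Λ) / 3 := by
  intro t ht
  obtain ⟨hp, hm⟩ := hshearfree t ht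
  have hp' := (hσp t ht).eq_zero_of_forall_mem_eq_zero hIopen ht fun x hx => (hshearfree x hx).1
  have hm' := (hσm t ht).eq_zero_of_forall_mem_eq_zero hIopen ht fun x hx => (hshearfree x hx).2
  rw [hp] at hp'
  rw [hm, mul_zero, zero_sub, neg_eq_zero, mul_assoc] at hm'
  obtain ⟨h₁₂, h₂₃⟩ := eq_of_shear_source_eq_zero (hn₁pos t ht) (hn₂pos t ht) (hn₃pos t ht)
    (by linarith) ((mul_eq_zero.mp hm').resolve_left (by positivity))
  refine ⟨h₁₂, h₂₃, ?_⟩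
  rw [hHam t ht, hp, hm, h₁₂, h₂₃]
  ring
end

section
/- Let (H, n₁, n₂, n₃, σ₊, σ₋, ρ) be a solution of the Bianchi VIII (SL̃(2,ℝ)) topo-GR system on an open interval I with n₁ < 0, n₂ > 0, n₃ > 0 on I, and suppose the solution is shear-free, i.e. σ₊ ≡ 0 and σ₋ ≡ 0 on I. Then n₁ + n₂ + n₃ = 0 on I and the expansion satisfies the flat-Friedmann constraint H² = (κρ + Λ)/3 on I. (In particular, contrary to all other geometries, shear-free Bianchi VIII solutions need not have n₂ = n₃, so the spatial metric need not be maximal.) -/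
open Real Filter

/-- Shear-free Bianchi VIII (SL̃(2,ℝ)) solutions of topo-GR: for a solution
of the Bianchi VIII topo-GR system on an open interval `I` with `n₁ < 0`,
`n₂ > 0`, `n₃ > 0`, if `σ₊ ≡ 0` and `σ₋ ≡ 0` on `I`, then `n₁ + n₂ + n₃ = 0`
on `I` and the expansion satisfies the flat-Friedmann constraint
`H² = (κρ + Λ)/3` on `I`. (Contrary to all other geometries, `n₂ = n₃` is
not forced, so the spatial metric need not be maximal.) -/
theorem topoGR_BianchiVIII_shear_free
    (κ Λ w : ℝ) (hκ : 0 < κ)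
    (I : Set ℝ) (hIopen : IsOpen I) (hIconn : Convex ℝ I)
    (H n₁ n₂ n₃ σp σm ρ : ℝ → ℝ)
    (hn₁neg : ∀ t ∈ I, n₁ t < 0)
    (hn₂pos : ∀ t ∈ I, 0 < n₂ t)
    (hn₃pos : ∀ t ∈ I, 0 < n₃ t)
    (hHam : ∀ t ∈ I, (H t) ^ 2 = (σp t) ^ 2 + (σm t) ^ 2
      + (1 / 12) * (n₁ t + n₂ t + n₃ t) ^ 2 + (κ * ρ t + Λ) / 3)
    (hRay : ∀ t ∈ I, HasDerivAt H
      (-(H t) ^ 2 - 2 * ((σp t) ^ 2 + (σm t) ^ 2)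
        - κ * (1 + 3 * w) * ρ t / 6 + Λ / 3) t)
    (hn₁ : ∀ t ∈ I, HasDerivAt n₁ (-(n₁ t) * (H t + 4 * σp t)) t)
    (hn₂ : ∀ t ∈ I, HasDerivAt n₂
      (-(n₂ t) * (H t - 2 * σp t - 2 * Real.sqrt 3 * σm t)) t)
    (hn₃ : ∀ t ∈ I, HasDerivAt n₃
      (-(n₃ t) * (H t - 2 * σp t + 2 * Real.sqrt 3 * σm t)) t)
    (hσp : ∀ t ∈ I, HasDerivAt σp
      (-3 * H t * σp t + (1 / 6) * (n₁ t + n₂ t + n₃ t)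
        * (2 * n₁ t - n₂ t - n₃ t)) t)
    (hσm : ∀ t ∈ I, HasDerivAt σm
      (-3 * H t * σm t + (1 / (2 * Real.sqrt 3)) * (n₁ t + n₂ t + n₃ t)
        * (n₃ t - n₂ t)) t)
    (hρ : ∀ t ∈ I, HasDerivAt ρ (-3 * (1 + w) * H t * ρ t) t)
    (hshearfree : ∀ t ∈ I, σp t = 0 ∧ σm t = 0) :
    ∀ t ∈ I, n₁ t + n₂ t + n₃ t = 0 ∧
      (H t) ^ 2 = (κ * ρ t + Λ) / 3 := by
  intro t ht
  obtain ⟨hp, hm⟩ := hshearfree t ht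
  have hderiv : HasDerivAt σp 0 t :=
    (hasDerivAt_const t (0 : ℝ)).congr_of_eventuallyEq <| by
      filter_upwards [hIopen.mem_nhds ht] with s hs using (hshearfree s hs).1
  have hprod := (hσp t ht).unique hderiv
  have hneg : 2 * n₁ t - n₂ t - n₃ t < 0 := by
    linarith [hn₁neg t ht, hn₂pos t ht, hn₃pos t ht]
  have hsum : n₁ t + n₂ t + n₃ t = 0 := by
    have h : (n₁ t + n₂ t + n₃ t) * (2 * n₁ t - n₂ t - n₃ t) = 0 := by
      rw [hp] at hprod
      linarith
    exact (mul_eq_zero.mp h).resolve_right hneg.ne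
  refine ⟨hsum, ?_⟩
  have h := hHam t ht
  rw [hp, hm, hsum] at h
  linarith
end

section
/- Let (H, n₂, n₃, σ₊, σ₋, ρ) be a solution of the Bianchi VI₀ (Sol) topo-GR system on an open interval I, and suppose the solution is shear-free, i.e. σ₊ ≡ 0 and σ₋ ≡ 0 on I. Then n₂ = −n₃ on I (the spatial metric is the maximal Sol metric) and the expansion satisfies the flat-Friedmann constraint H² = (κρ + Λ)/3 on I. Thus shear-free perfect-fluid Bianchi VI₀ solutions of topo-GR have exactly the dynamics of a flat FLRW model of general relativity. -/
open Real Filter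

/-- Shear-free Bianchi VI₀ (Sol) solutions of topo-GR: for a solution of the
Bianchi VI₀ topo-GR system on an open interval `I`, if `σ₊ ≡ 0` and `σ₋ ≡ 0`
on `I`, then `n₂ = −n₃` on `I` (the spatial metric is the maximal Sol metric)
and the expansion satisfies the flat-Friedmann constraint `H² = (κρ + Λ)/3`
on `I`, i.e. the dynamics is exactly that of a flat FLRW model of general
relativity. -/
theorem topoGR_BianchiVI0_shear_free
    (κ Λ w : ℝ) (hκ : 0 < κ)
    (I : Set ℝ) (hIopen : IsOpen I) (hIconn : Convex ℝ I)
    (H n₂ n₃ σp σm ρ : ℝ → ℝ)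
    (hHam : ∀ t ∈ I, (H t) ^ 2 = (σp t) ^ 2 + (σm t) ^ 2
      + (1 / 12) * (n₂ t + n₃ t) ^ 2 + (κ * ρ t + Λ) / 3)
    (hRay : ∀ t ∈ I, HasDerivAt H
      (-(H t) ^ 2 - 2 * ((σp t) ^ 2 + (σm t) ^ 2)
        - κ * (1 + 3 * w) * ρ t / 6 + Λ / 3) t)
    (hn₂ : ∀ t ∈ I, HasDerivAt n₂
      (-(n₂ t) * (H t - 2 * σp t - 2 * Real.sqrt 3 * σm t)) t)
    (hn₃ : ∀ t ∈ I, HasDerivAt n₃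
      (-(n₃ t) * (H t - 2 * σp t + 2 * Real.sqrt 3 * σm t)) t)
    (hσp : ∀ t ∈ I, HasDerivAt σp
      (-3 * H t * σp t - (1 / 6) * (n₂ t + n₃ t) ^ 2) t)
    (hσm : ∀ t ∈ I, HasDerivAt σm
      (-3 * H t * σm t - (1 / (2 * Real.sqrt 3)) * ((n₂ t) ^ 2 - (n₃ t) ^ 2)) t)
    (hρ : ∀ t ∈ I, HasDerivAt ρ (-3 * (1 + w) * H t * ρ t) t)
    (hshearfree : ∀ t ∈ I, σp t = 0 ∧ σm t = 0) :
    ∀ t ∈ I, n₂ t = -(n₃ t) ∧ (H t) ^ 2 = (κ * ρ t + Λ) / 3 := by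
  intro t ht
  obtain ⟨hp, hm⟩ := hshearfree t ht
  have hzero : σp =ᶠ[nhds t] fun _ => 0 :=
    (hIopen.eventually_mem ht).mono fun s hs => (hshearfree s hs).1
  have hderiv := (hσp t ht).unique ((hasDerivAt_const t (0 : ℝ)).congr_of_eventuallyEq hzero)
  rw [hp] at hderiv
  have hsum : n₂ t + n₃ t = 0 := pow_eq_zero_iff two_ne_zero |>.mp (by linarith)
  refine ⟨eq_neg_of_add_eq_zero_left hsum, ?_⟩
  have hH := hHam t ht
  rw [hp, hm, hsum] at hH
  linarith
end

section
/- Let (H, n₁, σ₊, r₂, ρ) be a solution of the LRS Bianchi II (Nil) topo-GR system on an open interval I with n₁ > 0 on I, and suppose the solution is shear-free, i.e. σ₊ ≡ 0 on I. Then r₂ = 1 on I (so the spatial Ricci curvature equals the reference Ricci curvature) and the expansion satisfies the flat-Friedmann constraint H² = (κρ + Λ)/3 on I. Thus shear-free perfect-fluid LRS Bianchi II solutions of topo-GR have exactly the dynamics of a flat FLRW model of general relativity. -/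
open Real Filter

/-- Shear-free LRS Bianchi II (Nil) solutions of topo-GR: for a solution of
the LRS Bianchi II topo-GR system on an open interval `I` with `n₁ > 0` and
`r₂ > 0` on `I`, if `σ₊ ≡ 0` on `I`, then `r₂ = 1` on `I` (the spatial Ricci
curvature equals the reference Ricci curvature) and the expansion satisfies
the flat-Friedmann constraint `H² = (κρ + Λ)/3` on `I`, i.e. the dynamics is
exactly that of a flat FLRW model of general relativity. -/
theorem topoGR_LRS_BianchiII_shear_free
    (κ Λ w : ℝ) (hκ : 0 < κ)
    (I : Set ℝ) (hIopen : IsOpen I) (hIconn : Convex ℝ I)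
    (H n₁ σp r₂ ρ : ℝ → ℝ)
    (hn₁pos : ∀ t ∈ I, 0 < n₁ t)
    (hr₂pos : ∀ t ∈ I, 0 < r₂ t)
    (hHam : ∀ t ∈ I, (H t) ^ 2 = (σp t) ^ 2
      + (1 / 12) * (n₁ t) ^ 2 * (r₂ t - 1) ^ 2 + (κ * ρ t + Λ) / 3)
    (hRay : ∀ t ∈ I, HasDerivAt H
      (-(H t) ^ 2 - 2 * (σp t) ^ 2 - κ * (1 + 3 * w) * ρ t / 6 + Λ / 3) t)
    (hn₁ : ∀ t ∈ I, HasDerivAt n₁ (-(n₁ t) * (H t + 4 * σp t)) t)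
    (hσp : ∀ t ∈ I, HasDerivAt σp
      (-3 * H t * σp t - ((n₁ t) ^ 2 / 6) * (r₂ t + 2) * (r₂ t - 1)) t)
    (hr₂ : ∀ t ∈ I, HasDerivAt r₂ (6 * r₂ t * σp t) t)
    (hρ : ∀ t ∈ I, HasDerivAt ρ (-3 * (1 + w) * H t * ρ t) t)
    (hshearfree : ∀ t ∈ I, σp t = 0) :
    ∀ t ∈ I, r₂ t = 1 ∧ (H t) ^ 2 = (κ * ρ t + Λ) / 3 := by
  intro t ht
  have hσ0 : HasDerivAt σp 0 t :=
    (hasDerivAt_const t (0 : ℝ)).congr_of_eventuallyEq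
      (Filter.eventually_of_mem (hIopen.mem_nhds ht) hshearfree)
  have hzero := (hσp t ht).unique hσ0
  have hσt := hshearfree t ht
  have hn := hn₁pos t ht
  have hr := hr₂pos t ht
  have hprod : ((n₁ t) ^ 2 / 6 * (r₂ t + 2)) * (r₂ t - 1) = 0 := by
    rw [hσt] at hzero
    linarith
  have hr1 : r₂ t = 1 :=
    sub_eq_zero.mp ((mul_eq_zero.mp hprod).resolve_left (by positivity))
  refine ⟨hr1, ?_⟩
  rw [hHam t ht, hσt, hr1]
  ring
end

section
/- Let (H, n₁, n₂, n₃, σ₊, σ₋, ρ) be a solution of the Bianchi IX topo-GR system on an open interval I, let t₀ ∈ I, and suppose the data are shear-free and isotropic at time t₀: σ₊(t₀) = 0, σ₋(t₀) = 0 and n₁(t₀) = n₂(t₀) = n₃(t₀). Then for all t ∈ I: σ₊(t) = 0, σ₋(t) = 0 and n₁(t) = n₂(t) = n₃(t); i.e. in topo-GR, a Bianchi IX metric that is shear-free and isotropic at one time remains so for all times. -/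
open Real Filter

open Set in
/-- A differentiable function on an open interval which satisfies `|f'| ≤ K |f|` for a continuous
`K` and vanishes at one point vanishes identically. -/
theorem eq_zero_of_abs_deriv_le_continuousOn_mul_abs {I : Set ℝ} (hI : Convex ℝ I)
    {f f' K : ℝ → ℝ} (hf : ∀ t ∈ I, HasDerivAt f (f' t) t) (hK : ContinuousOn K I)
    (bound : ∀ t ∈ I, |f' t| ≤ K t * |f t|) {t₀ : ℝ} (ht₀ : t₀ ∈ I) (h₀ : f t₀ = 0) :
    ∀ t ∈ I, f t = 0 := by
  intro t ht
  have hsub : uIcc t₀ t ⊆ I := hI.ordConnected.uIcc_subset ht₀ ht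
  obtain ⟨C, hC⟩ := isCompact_uIcc.bddAbove_image (hK.mono hsub)
  have hbound : ∀ s ∈ uIcc t₀ t, |f' s| ≤ C * |f s| := fun s hs =>
    (bound s (hsub hs)).trans
      (mul_le_mul_of_nonneg_right (hC (mem_image_of_mem K hs)) (abs_nonneg _))
  rcases le_total t₀ t with h | h
  · rw [uIcc_of_le h] at hsub hbound
    exact eq_zero_of_abs_deriv_le_mul_abs_self_of_eq_zero_right
      (fun s hs => (hf s (hsub hs)).continuousAt.continuousWithinAt)
      (fun s hs => (hf s (hsub (Ico_subset_Icc_self hs))).hasDerivWithinAt) h₀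
      (fun s hs => hbound s (Ico_subset_Icc_self hs)) t (right_mem_Icc.2 h)
  · rw [uIcc_of_ge h] at hsub hbound
    have hneg : ∀ s ∈ Icc (-t₀) (-t), -s ∈ Icc t t₀ := fun s hs =>
      ⟨by linarith [hs.2], by linarith [hs.1]⟩
    have hder : ∀ s ∈ Icc (-t₀) (-t), HasDerivAt (fun r => f (-r)) (-f' (-s)) s := fun s hs =>
      ((hf (-s) (hsub (hneg s hs))).comp s (hasDerivAt_neg s)).congr_deriv (mul_neg_one _)
    have key := eq_zero_of_abs_deriv_le_mul_abs_self_of_eq_zero_right (K := C)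
      (fun s hs => (hder s hs).continuousAt.continuousWithinAt)
      (fun s hs => (hder s (Ico_subset_Icc_self hs)).hasDerivWithinAt) (by simpa using h₀)
      (fun s hs => by simpa using hbound (-s) (hneg s (Ico_subset_Icc_self hs)))
      (-t) (right_mem_Icc.2 (neg_le_neg h))
    simpa using key

/-- A quadratic form in four real variables is bounded by the sum of the absolute values of its
coefficients times the squared Euclidean norm. -/
theorem abs_quadratic_form_le (a b c d e g h p m x y : ℝ) :
    |a * (p ^ 2 + m ^ 2) + b * (p * x) + c * (p * y) + d * (m * x) + e * (m * y)
        + g * x ^ 2 + h * y ^ 2|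
      ≤ (|a| + |b| + |c| + |d| + |e| + |g| + |h|) * (p ^ 2 + m ^ 2 + x ^ 2 + y ^ 2) := by
  have mul_bound : ∀ k u : ℝ, |u| ≤ p ^ 2 + m ^ 2 + x ^ 2 + y ^ 2 →
      |k * u| ≤ |k| * (p ^ 2 + m ^ 2 + x ^ 2 + y ^ 2) := fun k u hu => by
    rw [abs_mul]
    exact mul_le_mul_of_nonneg_left hu (abs_nonneg k)
  have ha := abs_le.1 (mul_bound a (p ^ 2 + m ^ 2) (abs_le.2 ⟨by nlinarith, by nlinarith⟩))
  have hb := abs_le.1 (mul_bound b (p * x) (abs_le.2 ⟨by nlinarith, by nlinarith⟩))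
  have hc := abs_le.1 (mul_bound c (p * y) (abs_le.2 ⟨by nlinarith, by nlinarith⟩))
  have hd := abs_le.1 (mul_bound d (m * x) (abs_le.2 ⟨by nlinarith, by nlinarith⟩))
  have he := abs_le.1 (mul_bound e (m * y) (abs_le.2 ⟨by nlinarith, by nlinarith⟩))
  have hg := abs_le.1 (mul_bound g (x ^ 2) (abs_le.2 ⟨by nlinarith, by nlinarith⟩))
  have hh := abs_le.1 (mul_bound h (y ^ 2) (abs_le.2 ⟨by nlinarith, by nlinarith⟩))
  simp only [add_mul _ _ (p ^ 2 + m ^ 2 + x ^ 2 + y ^ 2)]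
  exact abs_le.2 ⟨by linarith, by linarith⟩

/-- Persistence of shear-free isotropy for Bianchi IX models of topo-GR: for
a solution of the Bianchi IX topo-GR system on an open interval `I`, if the
data are shear-free and isotropic at some time `t₀ ∈ I`, i.e. `σ₊(t₀) = 0`,
`σ₋(t₀) = 0` and `n₁(t₀) = n₂(t₀) = n₃(t₀)`, then they remain so for all
`t ∈ I`. -/
theorem topoGR_BianchiIX_isotropy_persists
    (κ Λ w : ℝ) (hκ : 0 < κ)
    (I : Set ℝ) (hIopen : IsOpen I) (hIconn : Convex ℝ I)
    (H n₁ n₂ n₃ σp σm ρ : ℝ → ℝ)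
    (hHam : ∀ t ∈ I, (H t) ^ 2 = (σp t) ^ 2 + (σm t) ^ 2
      + (1 / 12) * ((n₁ t) ^ 2 + (n₂ t) ^ 2 + (n₃ t) ^ 2
        - n₁ t * n₂ t - n₂ t * n₃ t - n₃ t * n₁ t)
      + (κ * ρ t + Λ) / 3)
    (hRay : ∀ t ∈ I, HasDerivAt H
      (-(H t) ^ 2 - 2 * ((σp t) ^ 2 + (σm t) ^ 2)
        - κ * (1 + 3 * w) * ρ t / 6 + Λ / 3) t)
    (hn₁ : ∀ t ∈ I, HasDerivAt n₁ (-(n₁ t) * (H t + 4 * σp t)) t)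
    (hn₂ : ∀ t ∈ I, HasDerivAt n₂
      (-(n₂ t) * (H t - 2 * σp t - 2 * Real.sqrt 3 * σm t)) t)
    (hn₃ : ∀ t ∈ I, HasDerivAt n₃
      (-(n₃ t) * (H t - 2 * σp t + 2 * Real.sqrt 3 * σm t)) t)
    (hσp : ∀ t ∈ I, HasDerivAt σp
      (-3 * H t * σp t + (1 / 12) * (4 * (n₁ t) ^ 2 - 2 * (n₂ t) ^ 2
        - 2 * (n₃ t) ^ 2 + 2 * n₂ t * n₃ t - n₁ t * n₂ t - n₁ t * n₃ t)) t)
    (hσm : ∀ t ∈ I, HasDerivAt σm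
      (-3 * H t * σm t - (1 / (4 * Real.sqrt 3)) * (n₃ t - n₂ t)
        * (n₁ t - 2 * n₂ t - 2 * n₃ t)) t)
    (hρ : ∀ t ∈ I, HasDerivAt ρ (-3 * (1 + w) * H t * ρ t) t)
    (t₀ : ℝ) (ht₀ : t₀ ∈ I)
    (hσp₀ : σp t₀ = 0) (hσm₀ : σm t₀ = 0)
    (hn₁₂ : n₁ t₀ = n₂ t₀) (hn₂₃ : n₂ t₀ = n₃ t₀) :
    ∀ t ∈ I, σp t = 0 ∧ σm t = 0 ∧ n₁ t = n₂ t ∧ n₂ t = n₃ t := by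
  have cont : ∀ {f f' : ℝ → ℝ}, (∀ t ∈ I, HasDerivAt f (f' t) t) → ContinuousOn f I :=
    fun hf t ht => (hf t ht).continuousAt.continuousWithinAt
  have cH := cont hRay
  have c₁ := cont hn₁
  have c₂ := cont hn₂
  have c₃ := cont hn₃
  have cp := cont hσp
  let a : ℝ → ℝ := fun t => -6 * H t
  let b : ℝ → ℝ := fun t => -(11 / 6) * (4 * n₁ t + 2 * n₂ t)
  let c : ℝ → ℝ := fun t => (2 * n₃ t + n₁ t) / 6
  let d : ℝ → ℝ := fun t => -4 * √3 * n₂ t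
  let e : ℝ → ℝ := fun t =>
    1 / (2 * √3) * (n₁ t - 2 * n₂ t - 2 * n₃ t) + 4 * √3 * (n₂ t + n₃ t)
  let g : ℝ → ℝ := fun t => -2 * H t
  let h : ℝ → ℝ := fun t => -2 * H t + 4 * σp t
  let E : ℝ → ℝ := fun t =>
    σp t ^ 2 + σm t ^ 2 + (n₁ t - n₂ t) ^ 2 + (n₂ t - n₃ t) ^ 2
  have hE : ∀ t ∈ I, HasDerivAt E
      (a t * (σp t ^ 2 + σm t ^ 2) + b t * (σp t * (n₁ t - n₂ t)) + c t * (σp t * (n₂ t - n₃ t))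
        + d t * (σm t * (n₁ t - n₂ t)) + e t * (σm t * (n₂ t - n₃ t))
        + g t * (n₁ t - n₂ t) ^ 2 + h t * (n₂ t - n₃ t) ^ 2) t := fun t ht => by
    refine (((((hσp t ht).pow 2).add ((hσm t ht).pow 2)).add
      (((hn₁ t ht).sub (hn₂ t ht)).pow 2)).add
        (((hn₂ t ht).sub (hn₃ t ht)).pow 2)).congr_deriv ?_
    simp only [a, b, c, d, e, g, h, Pi.sub_apply]
    push_cast
    ring
  have hzero := eq_zero_of_abs_deriv_le_continuousOn_mul_abs hIconn hE
    (K := fun t => |a t| + |b t| + |c t| + |d t| + |e t| + |g t| + |h t|)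
    (by simp only [a, b, c, d, e, g, h]; fun_prop)
    (fun t _ => by
      rw [abs_of_nonneg (show 0 ≤ E t by positivity)]
      exact abs_quadratic_form_le _ _ _ _ _ _ _ _ _ _ _)
    ht₀ (by simp [E, hσp₀, hσm₀, hn₁₂, hn₂₃])
  intro t ht
  have hEt : σp t ^ 2 + σm t ^ 2 + (n₁ t - n₂ t) ^ 2 + (n₂ t - n₃ t) ^ 2 = 0 := hzero t ht
  have hp := sq_nonneg (σp t)
  have hm := sq_nonneg (σm t)
  have hx := sq_nonneg (n₁ t - n₂ t)
  have hy := sq_nonneg (n₂ t - n₃ t)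
  exact ⟨pow_eq_zero_iff two_ne_zero |>.1 (by linarith),
    pow_eq_zero_iff two_ne_zero |>.1 (by linarith),
    sub_eq_zero.1 (pow_eq_zero_iff two_ne_zero |>.1 (by linarith)),
    sub_eq_zero.1 (pow_eq_zero_iff two_ne_zero |>.1 (by linarith))⟩
end

section
/- Consider differentiable functions H, n₁, σ₊, σ₋, σ₂₃, r₂, r₃ : I → ℝ on an open real interval I with n₁ > 0, r₂ > 0 and r₃ > 0 on I, satisfying the general Bianchi II (Nil) topo-GR equations: (r₂ − r₃)·σ₋' = −3H(r₂ − r₃)σ₋ − (n₁²/(4√3))(r₂ − r₃)² + (2/√3)(r₂ + r₃)σ₂₃², (r₂ − r₃)·σ₂₃' = −3H(r₂ − r₃)σ₂₃ + 2√3·(r₂ + r₃)·σ₂₃·σ₋, r₂' = 2r₂(3σ₊ − √3·σ₋), and r₃' = 2r₃(3σ₊ + √3·σ₋). Then r₂ = r₃ on all of I if and only if σ₋ ≡ 0 and σ₂₃ ≡ 0 on I; i.e. for general Bianchi II solutions of topo-GR, local rotational symmetry (LRS) of the spacetime is equivalent to the isometries of the spatial metric being symmetries of the reference Ricci tensor (r₂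 = r₃). -/
open Real Filter

/-- For general Bianchi II (Nil-geometry) solutions of topo-GR, local
rotational symmetry (σ₋ ≡ 0 and σ₂₃ ≡ 0) is equivalent to the isometries of
the spatial metric being symmetries of the reference Ricci tensor, i.e. to
`r₂ = r₃` on the whole interval. -/
theorem topoGR_BianchiII_LRS_iff_r₂_eq_r₃
    (I : Set ℝ) (hIopen : IsOpen I) (hIconn : Convex ℝ I)
    (H n₁ σp σm σ₂₃ r₂ r₃ σm' σ₂₃' : ℝ → ℝ)
    (hn₁pos : ∀ t ∈ I, 0 < n₁ t)
    (hr₂pos : ∀ t ∈ I, 0 < r₂ t)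
    (hr₃pos : ∀ t ∈ I, 0 < r₃ t)
    (hσm : ∀ t ∈ I, HasDerivAt σm (σm' t) t)
    (hσ₂₃ : ∀ t ∈ I, HasDerivAt σ₂₃ (σ₂₃' t) t)
    (heqσm : ∀ t ∈ I, (r₂ t - r₃ t) * σm' t
      = -3 * H t * (r₂ t - r₃ t) * σm t
        - ((n₁ t) ^ 2 / (4 * Real.sqrt 3)) * (r₂ t - r₃ t) ^ 2
        + (2 / Real.sqrt 3) * (r₂ t + r₃ t) * (σ₂₃ t) ^ 2)
    (heqσ₂₃ : ∀ t ∈ I, (r₂ t - r₃ t) * σ₂₃' t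
      = -3 * H t * (r₂ t - r₃ t) * σ₂₃ t
        + 2 * Real.sqrt 3 * (r₂ t + r₃ t) * σ₂₃ t * σm t)
    (hr₂ : ∀ t ∈ I, HasDerivAt r₂
      (2 * r₂ t * (3 * σp t - Real.sqrt 3 * σm t)) t)
    (hr₃ : ∀ t ∈ I, HasDerivAt r₃
      (2 * r₃ t * (3 * σp t + Real.sqrt 3 * σm t)) t) :
    (∀ t ∈ I, r₂ t = r₃ t) ↔ (∀ t ∈ I, σm t = 0 ∧ σ₂₃ t = 0) := by
  have h3 : 0 < Real.sqrt 3 := by positivity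
  constructor
  · intro h t ht
    have hderiv := (hr₂ t ht).unique ((hr₃ t ht).congr_of_eventuallyEq
      (Filter.eventually_of_mem (hIopen.mem_nhds ht) h))
    have hr := h t ht
    have hpos := hr₃pos t ht
    constructor
    · rw [hr] at hderiv
      have hprod : (r₃ t * Real.sqrt 3) * σm t = 0 := by linarith
      exact (mul_eq_zero.mp hprod).resolve_left (by positivity)
    · have heq := heqσm t ht
      rw [hr] at heq
      have hprod : (2 / Real.sqrt 3 * (r₃ t + r₃ t)) * σ₂₃ t ^ 2 = 0 := by
        linear_combination -heq
      exact pow_eq_zero_iff two_ne_zero |>.mp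
        ((mul_eq_zero.mp hprod).resolve_left (by positivity))
  · intro h t ht
    have hderiv : σm' t = 0 := (hσm t ht).unique
      ((hasDerivAt_const t (0 : ℝ)).congr_of_eventuallyEq
        (Filter.eventually_of_mem (hIopen.mem_nhds ht) fun s hs => (h s hs).1))
    have hn := hn₁pos t ht
    have heq := heqσm t ht
    rw [hderiv, (h t ht).1, (h t ht).2] at heq
    have hprod : (n₁ t ^ 2 / (4 * Real.sqrt 3)) * (r₂ t - r₃ t) ^ 2 = 0 := by
      linear_combination heq
    exact sub_eq_zero.mp (pow_eq_zero_iff two_ne_zero |>.mp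
      ((mul_eq_zero.mp hprod).resolve_left (by positivity)))
end

section
/- Let H, n₂, n₃, σ₊, σ₋ : I → ℝ be differentiable on an open real interval I with n₂ > 0 on I, satisfying the Bianchi VII₀ frame equations n₂' = −n₂(H − 2σ₊ − 2√3·σ₋) and n₃' = −n₃(H − 2σ₊ + 2√3·σ₋). If n₂ = n₃ on all of I, then σ₋ ≡ 0 on I. Hence restricting a Bianchi VII₀ metric to be a Bianchi I metric (n₂ = n₃) forces the spacetime to be locally rotationally symmetric, so Bianchi VII₀ spacetime models do not contain general Bianchi I spacetime models. -/
open Real Filter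

/-- Restricting a Bianchi VII₀ metric to be a Bianchi I metric (`n₂ = n₃`)
forces the spacetime to be locally rotationally symmetric (`σ₋ ≡ 0`): if the
Bianchi VII₀ frame equations for `n₂` and `n₃` hold on an open interval `I`
with `n₂ > 0`, and `n₂ = n₃` on all of `I`, then `σ₋ = 0` on `I`. Hence
Bianchi VII₀ spacetime models do not contain general Bianchi I spacetime
models. -/
theorem BianchiVII0_eq_structure_constants_forces_LRS
    (I : Set ℝ) (hIopen : IsOpen I) (hIconn : Convex ℝ I)
    (H n₂ n₃ σp σm : ℝ → ℝ)
    (hn₂pos : ∀ t ∈ I, 0 < n₂ t)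
    (hn₂ : ∀ t ∈ I, HasDerivAt n₂
      (-(n₂ t) * (H t - 2 * σp t - 2 * Real.sqrt 3 * σm t)) t)
    (hn₃ : ∀ t ∈ I, HasDerivAt n₃
      (-(n₃ t) * (H t - 2 * σp t + 2 * Real.sqrt 3 * σm t)) t)
    (heq : ∀ t ∈ I, n₂ t = n₃ t) :
    ∀ t ∈ I, σm t = 0 := by
  intro t ht
  have hev : n₂ =ᶠ[nhds t] n₃ := eventually_of_mem (hIopen.mem_nhds ht) heq
  have hderiv := (hn₂ t ht).unique ((hn₃ t ht).congr_of_eventuallyEq hev)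
  rw [← heq t ht] at hderiv
  have hrate := mul_left_cancel₀ (neg_ne_zero.mpr (hn₂pos t ht).ne') hderiv
  have hmul : Real.sqrt 3 * σm t = 0 := by linarith
  exact (mul_eq_zero.mp hmul).resolve_left (by positivity)
end

section
/- Let U = {(x, y, z) ∈ ℝ³ : 0 < x < π} and define the vector fields ξ₁, ξ₂, ξ₃, ξ₄ : U → ℝ³ by ξ₁(x,y,z) = (cos y, −(cos x/sin x)·sin y, 0), ξ₂(x,y,z) = (sin y, (cos x/sin x)·cos y, 0), ξ₃(x,y,z) = (0, 1, 0), ξ₄(x,y,z) = (0, 0, 1). If v : U → ℝ³ is a continuously differentiable vector field whose Lie bracket with each ξᵢ vanishes on U, i.e. Dv(p)·ξᵢ(p) − Dξᵢ(p)·v(p) = 0 for all p ∈ U and i = 1, 2, 3, 4, then there is a constant c ∈ ℝ with v(p) = (0, 0, c) for all p ∈ U. (Vector-field part of Proposition A.6: every locally O(3)×IO(1)-invariant vector field on an ℝ×S²-geometric manifold is a constant multiple of ∂_z.) -/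
open Real

/-- The open region `0 < x < π` of `ℝ³` (coordinates `(x, y, z)`, with `x`
the polar angle on `S²`). -/
def RS2Domain : Set (Fin 3 → ℝ) := {p | 0 < p 0 ∧ p 0 < Real.pi}

/-- Generator `ξ₁` of the isometry group `O(3) × IO(1)` of the `ℝ×S²`
geometry. -/
noncomputable def xi1 : (Fin 3 → ℝ) → (Fin 3 → ℝ) := fun p =>
  ![Real.cos (p 1), -(Real.cos (p 0) / Real.sin (p 0)) * Real.sin (p 1), 0]

/-- Generator `ξ₂`. -/
noncomputable def xi2 : (Fin 3 → ℝ) → (Fin 3 → ℝ) := fun p =>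
  ![Real.sin (p 1), (Real.cos (p 0) / Real.sin (p 0)) * Real.cos (p 1), 0]

/-- Generator `ξ₃ = ∂_y`. -/
def xi3 : (Fin 3 → ℝ) → (Fin 3 → ℝ) := fun _ => ![0, 1, 0]

/-- Generator `ξ₄ = ∂_z`. -/
def xi4 : (Fin 3 → ℝ) → (Fin 3 → ℝ) := fun _ => ![0, 0, 1]

theorem hasDerivAt_cos_div_sin {x : ℝ} (hx : sin x ≠ 0) :
    HasDerivAt (fun t => cos t / sin t) (-(1 / sin x ^ 2)) x := by
  refine ((hasDerivAt_cos x).fun_div (hasDerivAt_sin x) hx).congr_deriv ?_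
  rw [← neg_div]
  congr 1
  linarith [sin_sq_add_cos_sq x]

theorem fderiv_vec_separated_apply {f g h : ℝ → ℝ} {f' g' h' : ℝ} {p : Fin 3 → ℝ}
    (hf : HasDerivAt f f' (p 1)) (hg : HasDerivAt g g' (p 0)) (hh : HasDerivAt h h' (p 1))
    (w : Fin 3 → ℝ) :
    fderiv ℝ (fun q : Fin 3 → ℝ => ![f (q 1), g (q 0) * h (q 1), 0]) p w =
      ![f' * w 1, g (p 0) * (h' * w 1) + h (p 1) * (g' * w 0), 0] := by
  let proj (i : Fin 3) : (Fin 3 → ℝ) →L[ℝ] ℝ := ContinuousLinearMap.proj i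
  have hf₁ := hf.comp_hasFDerivAt p (hasFDerivAt_apply (𝕜 := ℝ) 1 p)
  have hg₀ := hg.comp_hasFDerivAt p (hasFDerivAt_apply (𝕜 := ℝ) 0 p)
  have hh₁ := hh.comp_hasFDerivAt p (hasFDerivAt_apply (𝕜 := ℝ) 1 p)
  have key : HasFDerivAt (fun q : Fin 3 → ℝ => ![f (q 1), g (q 0) * h (q 1), 0])
      (ContinuousLinearMap.pi
        ![f' • proj 1, g (p 0) • h' • proj 1 + h (p 1) • g' • proj 0, 0]) p := by
    refine hasFDerivAt_pi.2 fun i => ?_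
    fin_cases i
    · exact hf₁
    · exact hg₀.mul hh₁
    · exact hasFDerivAt_const (0 : ℝ) p
  rw [key.fderiv]
  ext i
  fin_cases i <;> simp [proj]

theorem fderiv_xi1_apply {p : Fin 3 → ℝ} (hp : sin (p 0) ≠ 0) (w : Fin 3 → ℝ) :
    fderiv ℝ xi1 p w =
      ![-sin (p 1) * w 1,
        -(cos (p 0) / sin (p 0)) * (cos (p 1) * w 1) +
          sin (p 1) * (- -(1 / sin (p 0) ^ 2) * w 0), 0] :=
  fderiv_vec_separated_apply (hasDerivAt_cos _) (hasDerivAt_cos_div_sin hp).fun_neg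
    (hasDerivAt_sin _) w

theorem fderiv_xi2_apply {p : Fin 3 → ℝ} (hp : sin (p 0) ≠ 0) (w : Fin 3 → ℝ) :
    fderiv ℝ xi2 p w =
      ![cos (p 1) * w 1,
        cos (p 0) / sin (p 0) * (-sin (p 1) * w 1) +
          cos (p 1) * (-(1 / sin (p 0) ^ 2) * w 0), 0] :=
  fderiv_vec_separated_apply (hasDerivAt_sin _) (hasDerivAt_cos_div_sin hp)
    (hasDerivAt_cos _) w

theorem isOpen_RS2Domain : IsOpen RS2Domain :=
  (isOpen_lt continuous_const (continuous_apply 0)).inter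
    (isOpen_lt (continuous_apply 0) continuous_const)

theorem convex_RS2Domain : Convex ℝ RS2Domain :=
  (convex_Ioo (0 : ℝ) π).linear_preimage (LinearMap.proj 0 : (Fin 3 → ℝ) →ₗ[ℝ] ℝ)

/-- If `a cos t = -b sin t` and `a sin t = b cos t`, then `a = b = 0`. -/
theorem eq_zero_of_rotation {a b t : ℝ} (hc : a * cos t = -(b * sin t))
    (hs : a * sin t = b * cos t) : a = 0 ∧ b = 0 := by
  have ht := sin_sq_add_cos_sq t
  constructor
  · linear_combination cos t * hc + sin t * hs - a * ht
  · linear_combination sin t * hc - cos t * hs - b * ht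

/-- The bracket relations at a single point already force the first two components of `v` and the
whole derivative of `v` to vanish there. -/
theorem eq_zero_of_bracket_eq_zero {v : (Fin 3 → ℝ) → (Fin 3 → ℝ)} {p : Fin 3 → ℝ}
    (hp : sin (p 0) ≠ 0)
    (h1 : fderiv ℝ v p (xi1 p) - fderiv ℝ xi1 p (v p) = 0)
    (h2 : fderiv ℝ v p (xi2 p) - fderiv ℝ xi2 p (v p) = 0)
    (h3 : fderiv ℝ v p (xi3 p) - fderiv ℝ xi3 p (v p) = 0)
    (h4 : fderiv ℝ v p (xi4 p) - fderiv ℝ xi4 p (v p) = 0) :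
    v p 0 = 0 ∧ v p 1 = 0 ∧ fderiv ℝ v p = 0 := by
  set L := fderiv ℝ v p
  have hL1 : L ![0, 1, 0] = 0 := by
    have hconst : fderiv ℝ xi3 p = 0 := fderiv_const_apply _
    simpa [hconst, xi3] using h3
  have hL2 : L ![0, 0, 1] = 0 := by
    have hconst : fderiv ℝ xi4 p = 0 := fderiv_const_apply _
    simpa [hconst, xi4] using h4
  have hL (w : Fin 3 → ℝ) : L w = w 0 • L ![1, 0, 0] := by
    have hw : w = w 0 • ![1, 0, 0] + w 1 • ![0, 1, 0] + w 2 • ![0, 0, 1] := by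
      ext i
      fin_cases i <;> simp
    conv_lhs => rw [hw]
    simp only [map_add, map_smul, hL1, hL2, smul_zero, add_zero]
  set a := L ![1, 0, 0]
  rw [hL, fderiv_xi1_apply hp, sub_eq_zero] at h1
  rw [hL, fderiv_xi2_apply hp, sub_eq_zero] at h2
  have h10 := congrFun h1 0
  have h11 := congrFun h1 1
  have h12 := congrFun h1 2
  have h20 := congrFun h2 0
  have h21 := congrFun h2 1
  have h22 := congrFun h2 2
  simp only [xi1, xi2, Pi.smul_apply, smul_eq_mul, Matrix.cons_val] at h10 h11 h12 h20 h21 h22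
  obtain ⟨ha0, hv1⟩ := eq_zero_of_rotation (a := a 0) (b := v p 1) (t := p 1)
    (by linarith) (by linarith)
  rw [hv1] at h11 h21
  obtain ⟨ha1, hv0⟩ := eq_zero_of_rotation (a := a 1) (b := -(1 / sin (p 0) ^ 2 * v p 0)) (t := p 1)
    (by linarith) (by linarith)
  obtain ⟨ha2, -⟩ := eq_zero_of_rotation (a := a 2) (b := 0) (t := p 1)
    (by linarith) (by linarith)
  refine ⟨by simpa [hp] using hv0, hv1, ?_⟩
  have ha : a = 0 := by
    ext i
    fin_cases i
    exacts [ha0, ha1, ha2]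
  ext1 w
  rw [hL, ha, smul_zero, zero_apply]

/-- Vector-field part of Proposition A.6: every continuously differentiable
vector field on the region `0 < x < π` whose Lie bracket with each of the
generators `ξ₁, ξ₂, ξ₃, ξ₄` of `O(3) × IO(1)` vanishes is a constant multiple
of `∂_z`. -/
theorem rs2_invariant_vector_field_is_const_dz
    (v : (Fin 3 → ℝ) → (Fin 3 → ℝ))
    (hv : ContDiffOn ℝ 1 v RS2Domain)
    (h1 : ∀ p ∈ RS2Domain, fderiv ℝ v p (xi1 p) - fderiv ℝ xi1 p (v p) = 0)
    (h2 : ∀ p ∈ RS2Domain, fderiv ℝ v p (xi2 p) - fderiv ℝ xi2 p (v p) = 0)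
    (h3 : ∀ p ∈ RS2Domain, fderiv ℝ v p (xi3 p) - fderiv ℝ xi3 p (v p) = 0)
    (h4 : ∀ p ∈ RS2Domain, fderiv ℝ v p (xi4 p) - fderiv ℝ xi4 p (v p) = 0) :
    ∃ c : ℝ, ∀ p ∈ RS2Domain, v p = ![0, 0, c] := by
  have key : ∀ p ∈ RS2Domain, v p 0 = 0 ∧ v p 1 = 0 ∧ fderiv ℝ v p = 0 := fun p hp =>
    eq_zero_of_bracket_eq_zero (sin_pos_of_pos_of_lt_pi hp.1 hp.2).ne'
      (h1 p hp) (h2 p hp) (h3 p hp) (h4 p hp)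
  obtain ⟨c, hc⟩ := isOpen_RS2Domain.exists_is_const_of_fderiv_eq_zero
    convex_RS2Domain.isPreconnected (hv.differentiableOn one_ne_zero) fun p hp => (key p hp).2.2
  refine ⟨c 2, fun p hp => ?_⟩
  ext i
  fin_cases i
  exacts [(key p hp).1, (key p hp).2.1, congrFun (hc p hp) 2]
end
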